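/- Let c be a two-dimensional configuration over a finite alphabet that has low complexity with respect to a rectangle D = {1,…,n} × {1,…,m} for some n, m ≥ 1. Then the orbit closure of c contains a periodic configuration. -/

import Mathlib

/-- Translation of a configuration by `t`: `(Translate t c) n = c (n - t)`. -/
def Translate {A : Type*} (t : ℤ × ℤ) (c : ℤ × ℤ → A) : ℤ × ℤ → A :=
  fun n => c (n - t)

/-- The orbit of a configuration: the set of all its translates. -/
def orbit {A : Type*} (c : ℤ × ℤ → A) : Set (ℤ × ℤ → A) :=
  { d | ∃ t : ℤ × ℤ, d = Translate t c }

/-- The orbit closure: the topological closure of the orbit (in the product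
topology of the discrete topology on the alphabet). -/
def orbitClosure {A : Type*} [TopologicalSpace A] (c : ℤ × ℤ → A) : Set (ℤ × ℤ → A) :=
  closure (orbit c)

/-- The standard inner product on `ℤ²`. -/
def inner2 (x u : ℤ × ℤ) : ℤ := x.1 * u.1 + x.2 * u.2

/-- The discrete half plane in direction `u`. -/
def halfPlane (u : ℤ × ℤ) : Set (ℤ × ℤ) := { x | inner2 x u < 0 }

/-- A set of configurations is deterministic in direction `u`: the contents of a
configuration on the half plane `H_u` determine the whole configuration. -/
def DeterministicIn {A : Type*} (X : Set (ℤ × ℤ → A)) (u : ℤ × ℤ) : Prop :=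
  ∀ d ∈ X, ∀ e ∈ X, Set.EqOn d e (halfPlane u) → d = e

/-- The set of `D`-patterns appearing in `c` : restrictions of translates of `c` to `D`. -/
def patterns {A : Type*} (c : ℤ × ℤ → A) (D : Set (ℤ × ℤ)) : Set (D → A) :=
  { p | ∃ t : ℤ × ℤ, ∀ x : D, p x = Translate t c x }

/-- A configuration is periodic if it is fixed by some non-trivial translation. -/
def Periodic {A : Type*} (c : ℤ × ℤ → A) : Prop :=
  ∃ t : ℤ × ℤ, t ≠ 0 ∧ Translate t c = c

/-- The discrete rectangle `{1,…,n} × {1,…,m}`. -/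
def rect (n m : ℕ) : Set (ℤ × ℤ) :=
  { x | 1 ≤ x.1 ∧ x.1 ≤ (n : ℤ) ∧ 1 ≤ x.2 ∧ x.2 ≤ (m : ℤ) }

namespace LowComplexity

/-- The difference operator in direction `u`. -/
def diff (u : ℤ × ℤ) (g : ℤ × ℤ → ℤ) : ℤ × ℤ → ℤ := fun p => g (p - u) - g p

/-- The composition of the difference operators along a list of directions. -/
def diffs : List (ℤ × ℤ) → (ℤ × ℤ → ℤ) → ℤ × ℤ → ℤ
  | [], g => g
  | u :: l, g => diffs l (diff u g)

lemma diff_comm (u v : ℤ × ℤ) (g : ℤ × ℤ → ℤ) : diff u (diff v g) = diff v (diff u g) := by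
  funext p
  simp only [diff, sub_right_comm p u v]
  ring

lemma diffs_diff (l : List (ℤ × ℤ)) (u : ℤ × ℤ) (g : ℤ × ℤ → ℤ) :
    diffs l (diff u g) = diff u (diffs l g) := by
  induction l generalizing g with
  | nil => rfl
  | cons v l ih => rw [diffs, diffs, diff_comm, ih]

lemma diff_zero (u : ℤ × ℤ) : diff u 0 = 0 := by
  funext p
  simp [diff]

lemma diffs_sub (l : List (ℤ × ℤ)) (g h : ℤ × ℤ → ℤ) :
    diffs l (g - h) = diffs l g - diffs l h := by
  induction l generalizing g h with
  | nil => rfl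
  | cons u l ih =>
    rw [diffs, diffs, diffs, ← ih]
    congr 1
    funext p
    simp only [diff, Pi.sub_apply]
    ring

lemma diffs_append (l l' : List (ℤ × ℤ)) (g : ℤ × ℤ → ℤ) :
    diffs (l ++ l') g = diffs l' (diffs l g) := by
  induction l generalizing g with
  | nil => rfl
  | cons u l ih => exact ih _

lemma diffs_perm {l l' : List (ℤ × ℤ)} (h : l.Perm l') (g : ℤ × ℤ → ℤ) :
    diffs l g = diffs l' g := by
  induction h generalizing g with
  | nil => rfl
  | cons u _ ih => exact ih _
  | swap u v l => simp only [diffs, diff_comm]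
  | trans _ _ ih₁ ih₂ => rw [ih₁, ih₂]

lemma diffs_map_comp (M : (ℤ × ℤ) ≃+ (ℤ × ℤ)) (l : List (ℤ × ℤ)) (g : ℤ × ℤ → ℤ) :
    diffs l (g ∘ M) = diffs (l.map M) g ∘ M := by
  induction l generalizing g with
  | nil => rfl
  | cons u l ih =>
    rw [List.map_cons, diffs, diffs, ← ih]
    congr 1
    funext p
    simp [diff]

lemma diffs_translate (l : List (ℤ × ℤ)) (g : ℤ × ℤ → ℤ) (t : ℤ × ℤ) :
    diffs l (fun p => g (p + t)) = fun p => diffs l g (p + t) := by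
  induction l generalizing g with
  | nil => rfl
  | cons u l ih =>
    rw [diffs, diffs, ← ih]
    congr 1
    funext p
    simp [diff, add_sub_right_comm]

/-- A configuration of integers is bounded if its values lie in some `[-B, B]`. -/
def Bdd (g : ℤ × ℤ → ℤ) : Prop := ∃ B : ℤ, ∀ p, |g p| ≤ B

lemma Bdd.diff {g : ℤ × ℤ → ℤ} (hg : Bdd g) (u : ℤ × ℤ) : Bdd (diff u g) := by
  obtain ⟨B, hB⟩ := hg
  refine ⟨B + B, fun p => ?_⟩
  have h₁ := abs_le.1 (hB p)
  have h₂ := abs_le.1 (hB (p - u))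
  simp only [LowComplexity.diff]
  rw [abs_le]
  constructor <;> linarith

lemma Bdd.diffs {g : ℤ × ℤ → ℤ} (hg : Bdd g) (l : List (ℤ × ℤ)) : Bdd (diffs l g) := by
  induction l generalizing g with
  | nil => exact hg
  | cons u l ih => exact ih (hg.diff u)

lemma Bdd.sub {g h : ℤ × ℤ → ℤ} (hg : Bdd g) (hh : Bdd h) : Bdd (g - h) := by
  obtain ⟨B, hB⟩ := hg
  obtain ⟨C, hC⟩ := hh
  refine ⟨B + C, fun p => ?_⟩
  have h₁ := abs_le.1 (hB p)
  have h₂ := abs_le.1 (hC p)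
  rw [Pi.sub_apply, abs_le]
  constructor <;> linarith

lemma diff_eq_zero_iff {u : ℤ × ℤ} {g : ℤ × ℤ → ℤ} : diff u g = 0 ↔ ∀ p, g (p + u) = g p := by
  constructor
  · intro h p
    have := congrFun h (p + u)
    simp only [diff, add_sub_cancel_right, Pi.zero_apply] at this
    omega
  · intro h
    funext p
    have := h (p - u)
    simp only [sub_add_cancel] at this
    simp [diff, this]

lemma apply_add_zsmul {B : Type*} {u : ℤ × ℤ} {g : ℤ × ℤ → B} (h : ∀ p, g (p + u) = g p)
    (n : ℤ) (p : ℤ × ℤ) : g (p + n • u) = g p := by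
  induction n using Int.induction_on with
  | zero => simp
  | succ n ih => rw [add_smul, one_smul, ← add_assoc, h, ih]
  | pred n ih => rw [← ih, ← h (p + (-(n : ℤ) - 1) • u), sub_smul, one_smul]; congr 1; abel

lemma diff_zsmul_eq_zero {u : ℤ × ℤ} {g : ℤ × ℤ → ℤ} (h : diff u g = 0) (n : ℤ) :
    diff (n • u) g = 0 :=
  diff_eq_zero_iff.2 (apply_add_zsmul (diff_eq_zero_iff.1 h) n)

lemma diff_eq_zero_of_diff_diff {u : ℤ × ℤ} {g : ℤ × ℤ → ℤ} (hg : Bdd g)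
    (h : diff u (diff u g) = 0) : diff u g = 0 := by
  obtain ⟨B, hB⟩ := hg
  funext p
  by_contra hne
  have hlin : ∀ n : ℕ, g (p - (n : ℤ) • u) = g p + n * diff u g p := by
    intro n
    induction n with
    | zero => simp
    | succ n ih =>
      have h1 := apply_add_zsmul (diff_eq_zero_iff.1 h) (-(n : ℤ)) p
      rw [neg_smul, ← sub_eq_add_neg] at h1
      have h2 : p - ((n + 1 : ℕ) : ℤ) • u = p - (n : ℤ) • u - u := by
        push_cast
        rw [add_smul, one_smul]
        abel
      rw [h2]
      have h3 : diff u g (p - (n : ℤ) • u) = g (p - (n : ℤ) • u - u) - g (p - (n : ℤ) • u) := rfl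
      push_cast
      rw [h3] at h1
      linarith
  have hB0 : 0 ≤ B := (abs_nonneg _).trans (hB p)
  have h1 := hlin (2 * B + 1).toNat
  have h2 := abs_le.1 (hB (p - (((2 * B + 1).toNat : ℕ) : ℤ) • u))
  have h3 := abs_le.1 (hB p)
  rw [h1, Int.toNat_of_nonneg (by omega)] at h2
  rcases lt_or_gt_of_ne hne with h4 | h4
  · simp only [Pi.zero_apply] at h4
    nlinarith
  · simp only [Pi.zero_apply] at h4
    nlinarith

/-- A bounded configuration annihilated by differences in parallel directions is periodic. -/
lemma exists_period_of_horizontal (l : List (ℤ × ℤ)) (h0 : ∀ u ∈ l, u ≠ 0)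
    (h2 : ∀ u ∈ l, u.2 = 0) :
    ∃ a : ℤ, 0 < a ∧ ∀ g, Bdd g → diffs l g = 0 → diff (a, 0) g = 0 := by
  induction l with
  | nil =>
    refine ⟨1, one_pos, fun g _ h => ?_⟩
    simp only [diffs] at h
    rw [h, diff_zero]
  | cons u l ih =>
    obtain ⟨a, ha, h⟩ := ih (fun u hu => h0 u (by simp [hu])) (fun u hu => h2 u (by simp [hu]))
    obtain ⟨b, c⟩ := u
    have hc : c = 0 := h2 (b, c) (by simp)
    have hb : b ≠ 0 := fun hb => h0 (b, c) (by simp) (by simp [hb, hc])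
    subst hc
    refine ⟨|b| * a, by positivity, fun g hg hl => ?_⟩
    have e1 : ((|b| * a, 0) : ℤ × ℤ) = |b| • (a, 0) := by simp
    have e2 : ∃ n : ℤ, ((|b| * a, 0) : ℤ × ℤ) = n • (b, 0) := by
      rcases abs_choice b with hb' | hb'
      · exact ⟨a, by simp [hb', mul_comm]⟩
      · exact ⟨-a, by simp [hb', mul_comm]⟩
    obtain ⟨n, e2⟩ := e2
    have k1 := h _ (hg.diff _) hl
    rw [diff_comm] at k1
    have k2 := diff_zsmul_eq_zero k1 n
    rw [← e2, diff_comm] at k2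
    have k3 := diff_zsmul_eq_zero k2 |b|
    rw [← e1] at k3
    exact diff_eq_zero_of_diff_diff hg k3

lemma exists_diffs_horizontally_periodic (l : List (ℤ × ℤ)) (h0 : ∀ u ∈ l, u ≠ 0) :
    ∃ l' : List (ℤ × ℤ), (∀ u ∈ l', u.2 ≠ 0) ∧ ∃ a : ℤ, 0 < a ∧
      ∀ g, Bdd g → diffs l g = 0 → diff (a, 0) (diffs l' g) = 0 := by
  obtain ⟨a, ha, h⟩ := exists_period_of_horizontal (l.filter (fun u => decide (u.2 = 0)))
    (fun u hu => h0 u (List.mem_of_mem_filter hu))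
    (fun u hu => by simpa using (List.mem_filter.1 hu).2)
  refine ⟨l.filter (fun u => !decide (u.2 = 0)),
    fun u hu => by simpa using (List.mem_filter.1 hu).2,
    a, ha, fun g hg hl => h _ (hg.diffs _) ?_⟩
  rw [← diffs_append, ← hl]
  apply diffs_perm
  exact List.perm_append_comm.trans (List.filter_append_perm _ l)

/-- A configuration annihilated by differences in directions off the kernel of `φ` is determined
by its values on a half space of `φ`. -/
lemma eq_zero_of_diffs_of_halfspace (φ : ℤ × ℤ →+ ℝ) (l : List (ℤ × ℤ)) (hl : ∀ u ∈ l, φ u ≠ 0)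
    (d : ℤ × ℤ → ℤ) (h0 : ∀ p, φ p < 0 → d p = 0) (hd : diffs l d = 0) : d = 0 := by
  induction l generalizing d with
  | nil => exact hd
  | cons u l ih =>
    have hu := hl u (by simp)
    have ih' := ih (fun u hu => hl u (by simp [hu]))
    have hper : diff u d = 0 := by
      rcases lt_or_gt_of_ne hu with hu | hu
      · have h1 := ih' (fun p => diff u d (p + u)) (fun p hp => by
          have h2 : φ (p + u) < 0 := by rw [map_add]; linarith
          simp [diff, h0 p hp, h0 _ h2]) (by
          rw [diffs_translate]
          rw [diffs] at hd
          rw [hd]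
          rfl)
        funext p
        simpa using congrFun h1 (p - u)
      · refine ih' _ (fun p hp => ?_) hd
        have h2 : φ (p - u) < 0 := by rw [map_sub]; linarith
        simp [diff, h0 p hp, h0 _ h2]
    funext p
    rw [diff_eq_zero_iff] at hper
    obtain ⟨n, hn⟩ : ∃ n : ℤ, φ p + n * φ u < 0 := by
      rcases lt_or_gt_of_ne hu with hu | hu
      · obtain ⟨n, hn⟩ := exists_int_gt (φ p / (-φ u))
        refine ⟨n, ?_⟩
        rw [div_lt_iff₀ (by linarith)] at hn
        linarith
      · obtain ⟨n, hn⟩ := exists_int_gt (φ p / φ u)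
        refine ⟨-n, ?_⟩
        rw [div_lt_iff₀ (by linarith)] at hn
        push_cast
        linarith
    rw [← apply_add_zsmul hper n p]
    apply h0
    rw [map_add, map_zsmul, zsmul_eq_mul]
    exact hn

/-- A configuration annihilated by non-horizontal differences is determined by its values on a
sufficiently wide horizontal strip. -/
lemma eq_zero_of_diffs_of_strip (l : List (ℤ × ℤ)) (hl : ∀ u ∈ l, u.2 ≠ 0)
    (g : ℤ × ℤ → ℤ) (R W : ℤ) (hW : (l.map fun u => |u.2|).sum ≤ W)
    (h0 : ∀ p : ℤ × ℤ, R ≤ p.2 → p.2 < R + W → g p = 0) (hg : diffs l g = 0) : g = 0 := by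
  induction l generalizing g R W with
  | nil => exact hg
  | cons u l ih =>
    have hu := hl u (by simp)
    have ih' := ih (fun u hu => hl u (by simp [hu]))
    simp only [List.map_cons, List.sum_cons] at hW
    have hs : 0 ≤ (l.map fun u => |u.2|).sum := List.sum_nonneg fun x hx => by
      obtain ⟨v, _, rfl⟩ := List.mem_map.1 hx
      exact abs_nonneg _
    have hper : diff u g = 0 := by
      rcases lt_or_gt_of_ne hu with hu | hu
      · rw [abs_of_neg hu] at hW
        refine ih' _ R (W + u.2) (by linarith) (fun p h1 h2 => ?_) hg
        simp only [diff]
        rw [h0 p h1 (by linarith), h0 (p - u) (by simp; linarith) (by simp; linarith), sub_zero]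
      · rw [abs_of_pos hu] at hW
        refine ih' _ (R + u.2) (W - u.2) (by linarith) (fun p h1 h2 => ?_) hg
        simp only [diff]
        rw [h0 p (by linarith) (by linarith), h0 (p - u) (by simp; linarith) (by simp; linarith),
          sub_zero]
    funext p
    rw [diff_eq_zero_iff] at hper
    rw [← apply_add_zsmul hper (-((p.2 - R) / u.2)) p]
    have h1 := Int.emod_nonneg (p.2 - R) hu
    have h2 := Int.emod_lt_abs (p.2 - R) hu
    have h3 := Int.mul_ediv_add_emod (p.2 - R) u.2
    have h4 : (p + (-((p.2 - R) / u.2)) • u).2 = R + (p.2 - R) % u.2 := by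
      simp only [Prod.snd_add, Prod.smul_snd, smul_eq_mul]
      linarith
    apply h0 <;> rw [h4] <;> linarith

/-- Translations of integer configurations, as a monoid homomorphism into the endomorphisms. -/
def translationHom : Multiplicative (ℤ × ℤ) →* Module.End ℤ (ℤ × ℤ → ℤ) where
  toFun u :=
    { toFun := fun g p => g (p - u.toAdd)
      map_add' := fun _ _ => rfl
      map_smul' := fun _ _ => rfl }
  map_one' := by
    ext g p
    simp
  map_mul' u v := by
    ext g p
    simp [sub_sub]

/-- The action of Laurent polynomials on integer configurations. -/
noncomputable def laurentAction :
    AddMonoidAlgebra ℤ (ℤ × ℤ) →ₐ[ℤ] Module.End ℤ (ℤ × ℤ → ℤ) :=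
  AddMonoidAlgebra.lift ℤ _ _ translationHom

lemma laurentAction_single (u : ℤ × ℤ) (a : ℤ) (g : ℤ × ℤ → ℤ) (p : ℤ × ℤ) :
    laurentAction (AddMonoidAlgebra.single u a) g p = a * g (p - u) := by
  simp [laurentAction, AddMonoidAlgebra.lift_single, translationHom]

lemma laurentAction_sum {ι : Type*} (s : Finset ι) (a : ι → ℤ) (e : ι → ℤ × ℤ) (g : ℤ × ℤ → ℤ)
    (p : ℤ × ℤ) : laurentAction (∑ i ∈ s, AddMonoidAlgebra.single (e i) (a i)) g p =
      ∑ i ∈ s, a i * g (p - e i) := by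
  rw [map_sum, LinearMap.sum_apply, Finset.sum_apply]
  simp only [laurentAction_single]

lemma exists_sum_single_pow_prime {ι : Type*} [DecidableEq ι] (s : Finset ι) (a : ι → ℤ)
    (e : ι → ℤ × ℤ) (p : ℕ) (hp : p.Prime) :
    ∃ r : AddMonoidAlgebra ℤ (ℤ × ℤ), (∑ i ∈ s, AddMonoidAlgebra.single (e i) (a i)) ^ p =
      ∑ i ∈ s, AddMonoidAlgebra.single (p • e i) (a i) + (p : AddMonoidAlgebra ℤ (ℤ × ℤ)) * r := by
  induction s using Finset.induction_on with
  | empty => exact ⟨0, by simp [hp.ne_zero]⟩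
  | insert i s hi ih =>
    obtain ⟨r, hr⟩ := ih
    rw [Finset.sum_insert hi, Finset.sum_insert hi]
    obtain ⟨r', hr'⟩ := exists_add_pow_prime_eq hp (AddMonoidAlgebra.single (e i) (a i))
      (∑ i ∈ s, AddMonoidAlgebra.single (e i) (a i))
    have := Fact.mk hp
    obtain ⟨b, hb⟩ : (p : ℤ) ∣ a i ^ p - a i := by
      rw [← ZMod.intCast_zmod_eq_zero_iff_dvd (a i ^ p - a i) p]
      simp [ZMod.pow_card]
    have hb' : a i ^ p = a i + p * b := by linarith
    refine ⟨AddMonoidAlgebra.single (p • e i) b + r +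
      AddMonoidAlgebra.single (e i) (a i) * (∑ i ∈ s, AddMonoidAlgebra.single (e i) (a i)) * r', ?_⟩
    have h1 : AddMonoidAlgebra.single (p • e i) (a i + p * b) =
        AddMonoidAlgebra.single (p • e i) (a i) +
        (p : AddMonoidAlgebra ℤ (ℤ × ℤ)) * AddMonoidAlgebra.single (p • e i) b := by
      rw [AddMonoidAlgebra.single_add, ← nsmul_eq_mul, ← nsmul_eq_mul]
      simp
    rw [hr', hr, AddMonoidAlgebra.single_pow, hb', h1]
    ring

lemma sum_translates_eq_zero_of_prime (s : Finset (ℤ × ℤ)) (a : ℤ × ℤ → ℤ) (e : ℤ × ℤ → ℤ × ℤ)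
    (c : ℤ × ℤ → ℤ) (B : ℤ) (hB : ∀ q, |c q| ≤ B)
    (h : ∀ q, ∑ u ∈ s, a u * c (q - e u) = 0) (p : ℕ) (hp : p.Prime)
    (hlt : (∑ u ∈ s, |a u|) * B < p) (q : ℤ × ℤ) :
    ∑ u ∈ s, a u * c (q - p • e u) = 0 := by
  obtain ⟨r, hr⟩ := exists_sum_single_pow_prime s a e p hp
  have h1 : laurentAction (∑ i ∈ s, AddMonoidAlgebra.single (e i) (a i)) c = 0 := by
    funext q
    rw [laurentAction_sum]
    exact h q
  have h2 : laurentAction ((∑ i ∈ s, AddMonoidAlgebra.single (e i) (a i)) ^ p) c = 0 := by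
    obtain ⟨k, rfl⟩ : ∃ k, p = k + 1 := ⟨p - 1, by have := hp.pos; omega⟩
    rw [pow_succ, map_mul, Module.End.mul_apply, h1, map_zero]
  rw [hr, map_add, map_mul, map_natCast] at h2
  have h3 := congrFun h2 q
  rw [LinearMap.add_apply, Pi.add_apply, laurentAction_sum, Module.End.mul_apply] at h3
  have h4 : ((p : Module.End ℤ (ℤ × ℤ → ℤ)) (laurentAction r c)) q = p * laurentAction r c q := by
    rw [← nsmul_one p]
    simp
  rw [h4, Pi.zero_apply] at h3
  refine Int.eq_zero_of_abs_lt_dvd (m := (p : ℤ)) ⟨-laurentAction r c q, by linarith⟩ ?_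
  refine lt_of_le_of_lt (Finset.abs_sum_le_sum_abs _ _) (lt_of_le_of_lt ?_ hlt)
  rw [Finset.sum_mul]
  refine Finset.sum_le_sum fun u _ => ?_
  rw [abs_mul]
  exact mul_le_mul_of_nonneg_left (hB _) (abs_nonneg _)

lemma sum_translates_eq_zero_of_large_factors (s : Finset (ℤ × ℤ)) (a : ℤ × ℤ → ℤ)
    (c : ℤ × ℤ → ℤ) (B : ℤ) (hB : ∀ q, |c q| ≤ B)
    (h : ∀ q, ∑ u ∈ s, a u * c (q - u) = 0) (r : ℕ) (hr : r ≠ 0)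
    (hlt : ∀ p : ℕ, p.Prime → p ∣ r → (∑ u ∈ s, |a u|) * B < p) (q : ℤ × ℤ) :
    ∑ u ∈ s, a u * c (q - r • u) = 0 := by
  induction r using induction_on_primes generalizing q with
  | zero => exact absurd rfl hr
  | one => simpa using h q
  | prime_mul p r hp ih =>
    have hr' : r ≠ 0 := by rintro rfl; simp at hr
    have := sum_translates_eq_zero_of_prime s a (fun u => r • u) c B hB
      (ih hr' fun p' hp' hd => hlt p' hp' (hd.mul_left p)) p hp (hlt p hp (dvd_mul_right p r)) q
    simpa only [mul_smul] using this

/-- Elimination: if translates of a family of configurations along all multiples of distinct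
vectors sum to zero, then each of them is annihilated by a product of differences. -/
lemma exists_diffs_eq_zero_of_sum (N : ℤ) (hN : N ≠ 0) (s : Finset (ℤ × ℤ))
    (g : ℤ × ℤ → ℤ × ℤ → ℤ)
    (h : ∀ (k : ℕ) q, ∑ u ∈ s, g u (q - (k * N) • u) = 0) (u₀ : ℤ × ℤ) (hu₀ : u₀ ∈ s) :
    ∃ l : List (ℤ × ℤ), (∀ u ∈ l, u ≠ 0) ∧ diffs l (g u₀) = 0 := by
  induction hn : s.card generalizing s g with
  | zero => simp_all
  | succ n ih =>
    by_cases hs : s = {u₀}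
    · refine ⟨[], by simp, ?_⟩
      funext q
      simpa [hs, diffs] using h 0 q
    · obtain ⟨w, hw, hne⟩ : ∃ w ∈ s, w ≠ u₀ := by
        by_contra! hall
        exact hs (Finset.eq_singleton_iff_unique_mem.2 ⟨hu₀, hall⟩)
      obtain ⟨l, hl, hl'⟩ := ih (s.erase w) (fun u => diff (N • (u - w)) (g u)) (fun k q => by
        have h1 := h (k + 1) (q + N • w)
        have h2 := h k q
        have h3 : ∑ u ∈ s, diff (N • (u - w)) (g u) (q - (k * N) • u) = 0 := by
          simp only [diff]
          rw [Finset.sum_sub_distrib, h2, sub_zero, ← h1]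
          refine Finset.sum_congr rfl fun u _ => ?_
          congr 1
          push_cast
          rw [add_mul, add_smul, one_mul, smul_sub]
          abel
        rw [← h3]
        refine Finset.sum_subset (Finset.erase_subset _ _) fun u hu hu' => ?_
        have : u = w := by
          by_contra huw
          exact hu' (Finset.mem_erase.2 ⟨huw, hu⟩)
        simp [this, diff]) (Finset.mem_erase.2 ⟨hne.symm, hu₀⟩) (by
          rw [Finset.card_erase_of_mem hw, hn, Nat.add_sub_cancel])
      refine ⟨(N • (u₀ - w)) :: l, ?_, hl'⟩
      intro u hu
      rcases List.mem_cons.1 hu with rfl | hu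
      · exact smul_ne_zero hN (sub_ne_zero.2 hne.symm)
      · exact hl u hu

lemma exists_diffs_of_annihilator (s : Finset (ℤ × ℤ)) (a : ℤ × ℤ → ℤ) (u₀ : ℤ × ℤ)
    (hu₀ : u₀ ∈ s) (ha : a u₀ ≠ 0) (c : ℤ × ℤ → ℤ) (hc : Bdd c)
    (h : ∀ q, ∑ u ∈ s, a u * c (q - u) = 0) :
    ∃ l : List (ℤ × ℤ), (∀ u ∈ l, u ≠ 0) ∧ diffs l c = 0 := by
  obtain ⟨B, hB⟩ := hc
  set K : ℕ := ((∑ u ∈ s, |a u|) * B).toNat with hK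
  obtain ⟨l, hl, hl'⟩ := exists_diffs_eq_zero_of_sum (K.factorial : ℤ)
    (by exact_mod_cast K.factorial_ne_zero) s (fun u q => a u * c (q - u)) (fun k q => by
      have := sum_translates_eq_zero_of_large_factors s a c B hB h (1 + k * K.factorial)
        (by omega) (fun p hp hd => by
          by_contra! hle
          have hpK : p ≤ K := by
            have := Int.toNat_le_toNat hle
            simpa using this
          have h1 : p ∣ k * K.factorial := ((Nat.dvd_factorial hp.pos hpK)).mul_left k
          have h2 : p ∣ 1 := (Nat.dvd_add_left h1).1 hd
          exact hp.one_lt.ne' (Nat.dvd_one.1 h2)) q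
      rw [← this]
      refine Finset.sum_congr rfl fun u _ => ?_
      congr 2
      rw [sub_sub, ← natCast_zsmul]
      push_cast
      rw [add_smul, one_smul, add_comm]) u₀ hu₀
  refine ⟨l, hl, ?_⟩
  have h1 : ∀ (l : List (ℤ × ℤ)) (b : ℤ) (g : ℤ × ℤ → ℤ), diffs l (b • g) = b • diffs l g := by
    intro l b
    induction l with
    | nil => exact fun _ => rfl
    | cons u l ih =>
      intro g
      rw [diffs, diffs, ← ih]
      congr 1
      funext p
      simp only [diff, Pi.smul_apply, smul_eq_mul]
      ring
  have h2 : (fun q => a u₀ * c (q - u₀)) = a u₀ • fun q => c (q + -u₀) := by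
    funext q
    simp [sub_eq_add_neg]
  rw [h2, h1, smul_eq_zero_iff_right ha, diffs_translate] at hl'
  funext q
  simpa using congrFun hl' (q + u₀)

lemma ncard_image_add_le_of_subset {T α β : Type*} {s s' : Set T} (hs : s' ⊆ s) (F : T → α)
    (π : α → β) (hfin : (F '' s).Finite) :
    (F '' s').ncard + ((fun t => π (F t)) '' s).ncard ≤
      (F '' s).ncard + ((fun t => π (F t)) '' s').ncard := by
  have h1 : F '' s' ⊆ F '' s := Set.image_mono hs
  have h2 : (fun t => π (F t)) '' s' ⊆ (fun t => π (F t)) '' s := Set.image_mono hs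
  have hfin2 : ((fun t => π (F t)) '' s).Finite := by
    have := hfin.image π
    rwa [Set.image_image] at this
  have h3 : (fun t => π (F t)) '' s \ (fun t => π (F t)) '' s' ⊆ π '' (F '' s \ F '' s') := by
    rintro _ ⟨⟨t, ht, rfl⟩, hn⟩
    refine ⟨F t, ⟨⟨t, ht, rfl⟩, ?_⟩, rfl⟩
    rintro ⟨t', ht', h⟩
    exact hn ⟨t', ht', by simp only [h]⟩
  have h4 := Set.ncard_le_ncard h3 ((hfin.subset Set.sdiff_subset).image π)
  have h5 := Set.ncard_image_le (f := π) (hfin.subset (Set.sdiff_subset (t := F '' s')))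
  have h6 := Set.ncard_sdiff_add_ncard_of_subset h1 hfin
  have h7 := Set.ncard_sdiff_add_ncard_of_subset h2 hfin2
  omega

lemma ncard_add_ncard_le_of_ambiguous {T α β : Type*} (s : Set T) (F : T → α) (π : α → β)
    (hfin : (F '' s).Finite) (W : Set β)
    (hW : ∀ w ∈ W, ∃ t ∈ s, ∃ t' ∈ s, π (F t) = w ∧ π (F t') = w ∧ F t ≠ F t') :
    ((fun t => π (F t)) '' s).ncard + W.ncard ≤ (F '' s).ncard := by
  choose t ht t' ht' h1 h2 h3 using hW
  set Z : Set α := {a | ∃ w, ∃ h : w ∈ W, F (t w h) = a} with hZ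
  have hZs : Z ⊆ F '' s := by
    rintro _ ⟨w, h, rfl⟩
    exact ⟨_, ht w h, rfl⟩
  have h4 : W ⊆ π '' Z := fun w h => ⟨_, ⟨w, h, rfl⟩, h1 w h⟩
  have h5 : (fun t => π (F t)) '' s ⊆ π '' (F '' s \ Z) := by
    rintro _ ⟨u, hu, rfl⟩
    by_cases huZ : F u ∈ Z
    · obtain ⟨w, h, hw⟩ := huZ
      refine ⟨F (t' w h), ⟨⟨_, ht' w h, rfl⟩, ?_⟩, ?_⟩
      · rintro ⟨w', h', hw'⟩
        have : w' = w := by rw [← h1 w' h', hw', h2]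
        subst this
        exact h3 _ _ hw'
      · simp only
        rw [h2, ← hw, h1]
    · exact ⟨F u, ⟨⟨u, hu, rfl⟩, huZ⟩, rfl⟩
  have h6 := Set.ncard_le_ncard h4 ((hfin.subset hZs).image π)
  have h7 := Set.ncard_image_le (f := π) (hfin.subset hZs)
  have h8 := Set.ncard_le_ncard h5 ((hfin.subset Set.sdiff_subset).image π)
  have h9 := Set.ncard_image_le (f := π) (hfin.subset (Set.sdiff_subset (t := Z)))
  have h10 := Set.ncard_sdiff_add_ncard_of_subset hZs hfin
  omega

/-- The observation of a context `h` followed by the first `j` letters of a word `g`. -/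
def window {T Γ B : Type*} (h : T → Γ) (g : T → ℕ → B) (j : ℕ) (t : T) : Γ × (Fin j → B) :=
  (h t, fun i => g t i)

lemma exists_determined_letter {T Γ B : Type*} [Finite B] [Finite Γ] (s : Set T) (h : T → Γ)
    (g : T → ℕ → B) (n : ℕ) (hn : (window h g n '' s).ncard < (h '' s).ncard + n) :
    ∃ j < n, ∀ t ∈ s, ∀ t' ∈ s, h t = h t' → (∀ i < j, g t i = g t' i) → g t j = g t' j := by
  obtain ⟨j, hj, hle⟩ : ∃ j < n,
      (window h g (j + 1) '' s).ncard ≤ (window h g j '' s).ncard := by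
    by_contra! hall
    have h0 : ∀ j ≤ n, (h '' s).ncard + j ≤ (window h g j '' s).ncard := by
      intro j
      induction j with
      | zero =>
        intro _
        have : h '' s ⊆ Prod.fst '' (window h g 0 '' s) := by
          rintro _ ⟨t, ht, rfl⟩
          exact ⟨_, ⟨t, ht, rfl⟩, rfl⟩
        exact (Set.ncard_le_ncard this (Set.toFinite _)).trans (Set.ncard_image_le (Set.toFinite _))
      | succ j ih =>
        intro hj
        have := hall j hj
        have := ih (by omega)
        omega
    have := h0 n le_rfl
    omega
  refine ⟨j, hj, fun t ht t' ht' h1 h2 => ?_⟩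
  set π : Γ × (Fin (j + 1) → B) → Γ × (Fin j → B) := fun a => (a.1, fun i => a.2 i.castSucc) with hπ
  have himg : window h g j '' s = π '' (window h g (j + 1) '' s) := by
    rw [Set.image_image]
    rfl
  have hinj := Set.injOn_of_ncard_image_eq (f := π) (s := window h g (j + 1) '' s)
    (le_antisymm (Set.ncard_image_le (Set.toFinite _)) (himg ▸ hle)) (Set.toFinite _)
  have heq := hinj ⟨t, ht, rfl⟩ ⟨t', ht', rfl⟩ (by
    simp only [hπ, window, Prod.mk.injEq]
    exact ⟨h1, funext fun i => h2 i i.2⟩)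
  have := congrFun (congrArg Prod.snd heq) (Fin.last j)
  simpa [window] using this

/-- A Morse–Hedlund theorem with a periodic context. -/
lemma exists_period_of_window_count {Γ B : Type*} [Finite B] [Finite Γ] (h : ℤ → Γ) (g : ℤ → B)
    (q : ℤ) (hq : 0 < q) (hper : ∀ m, h (m + q) = h m) (n : ℕ)
    (hn : (Set.range (window h (fun m i => g (m + i)) n)).ncard < (Set.range h).ncard + n) :
    ∃ q : ℤ, 0 < q ∧ ∀ m, g (m + q) = g m := by
  have hper' : ∀ m (c : ℤ), h (m + c * q) = h m := by
    intro m c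
    induction c using Int.induction_on with
    | zero => simp
    | succ n ih => rw [add_mul, one_mul, ← add_assoc, hper, ih]
    | pred n ih => rw [← ih, ← hper]; congr 1; ring
  rw [← Set.image_univ, ← Set.image_univ] at hn
  obtain ⟨j, -, hdet⟩ := exists_determined_letter _ _ _ _ hn
  simp only [Set.mem_univ, forall_const] at hdet
  have hfwd : ∀ m m' c : ℤ, m' = m + c * q → (∀ i : ℕ, i < j → g (m + i) = g (m' + i)) →
      ∀ i : ℕ, g (m + i) = g (m' + i) := by
    intro m m' c hc hi i
    induction i using Nat.strong_induction_on with
    | _ i ih =>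
      by_cases hij : i < j
      · exact hi i hij
      · obtain ⟨e, rfl⟩ : ∃ e, i = e + j := ⟨i - j, by omega⟩
        have := hdet (m + e) (m' + e) (by rw [hc, add_right_comm, hper']) (fun i hi => by
          have := ih (e + i) (by omega)
          push_cast at this
          rw [add_assoc, add_assoc, this])
        push_cast
        rw [← add_assoc, ← add_assoc, this]
  cases nonempty_fintype (Fin j → B)
  set K := Fintype.card (Fin j → B) with hK
  refine ⟨K.factorial * q, by positivity, fun m => ?_⟩
  obtain ⟨a, b, hab, heq⟩ := Fintype.exists_ne_map_eq_of_card_lt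
    (fun (a : Fin (K + 1)) (i : Fin j) => g (m - a * q + i)) (by simp [hK])
  wlog hlt : a < b generalizing a b
  · exact this b a hab.symm heq.symm (lt_of_le_of_ne (not_lt.1 hlt) hab.symm)
  have hstep : ∀ z : ℤ, m - b * q ≤ z → g (z + ((b : ℤ) - a) * q) = g z := by
    intro z hz
    have := hfwd (m - b * q) (m - a * q) ((b : ℤ) - a) (by ring)
      (fun i hi => (congrFun heq ⟨i, hi⟩).symm) (z - (m - b * q)).toNat
    rw [Int.toNat_of_nonneg (by linarith)] at this
    rw [show z = m - b * q + (z - (m - b * q)) by ring, this]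
    congr 1
    ring
  have hiter : ∀ i : ℕ, g (m + i * (((b : ℤ) - a) * q)) = g m := by
    intro i
    have hba : (a : ℤ) < b := by exact_mod_cast hlt
    induction i with
    | zero => simp
    | succ i ih =>
      rw [← ih, ← hstep (m + i * (((b : ℤ) - a) * q))]
      · congr 1
        push_cast
        ring
      · have : 0 ≤ (i : ℤ) * (((b : ℤ) - a) * q) :=
          mul_nonneg (by positivity) (mul_nonneg (by linarith) hq.le)
        have : 0 ≤ (b : ℤ) * q := by positivity
        linarith
  have hlt' : (a : ℕ) < b := hlt
  obtain ⟨i, hi⟩ : ((b : ℕ) - a) ∣ K.factorial :=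
    Nat.dvd_factorial (by omega) (by have := b.2; omega)
  rw [← hiter i]
  congr 2
  rw [hi]
  push_cast [hlt'.le]
  ring

/-- The configuration `x` seen from the position `t`. -/
def shift {A : Type*} (t : ℤ × ℤ) (x : ℤ × ℤ → A) : ℤ × ℤ → A := fun p => x (p + t)

/-- A set of configurations is invariant if it contains all shifts of its elements. -/
def Invariant {A : Type*} (X : Set (ℤ × ℤ → A)) : Prop := ∀ x ∈ X, ∀ t, shift t x ∈ X

/-- The set contains a periodic configuration. -/
def HasPeriodic {A : Type*} (X : Set (ℤ × ℤ → A)) : Prop :=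
  ∃ x ∈ X, ∃ t : ℤ × ℤ, t ≠ 0 ∧ ∀ p, x (p + t) = x p

lemma bdd_comp {A : Type*} [Finite A] (val : A → ℤ) (x : ℤ × ℤ → A) : Bdd (val ∘ x) := by
  obtain ⟨B, hB⟩ := (Set.finite_range fun a => |val a|).bddAbove
  exact ⟨B, fun p => hB ⟨x p, rfl⟩⟩

lemma exists_common_period {A : Type*} (x : ℤ × ℤ → A) (s : Finset ℤ)
    (h : ∀ r ∈ s, ∃ q : ℤ, 0 < q ∧ ∀ i, x (i + q, r) = x (i, r)) :
    ∃ q : ℤ, 0 < q ∧ ∀ r ∈ s, ∀ c i : ℤ, x (i + c * q, r) = x (i, r) := by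
  have hmul : ∀ (r q : ℤ), (∀ i, x (i + q, r) = x (i, r)) → ∀ c i, x (i + c * q, r) = x (i, r) := by
    intro r q h c i
    induction c using Int.induction_on with
    | zero => simp
    | succ n ih => rw [add_mul, one_mul, ← add_assoc, h, ih]
    | pred n ih => rw [← ih, ← h]; congr 2; ring
  induction s using Finset.induction_on with
  | empty => exact ⟨1, one_pos, by simp⟩
  | insert r s hr ih =>
    obtain ⟨q, hq, hs⟩ := ih fun r hr => h r (Finset.mem_insert_of_mem hr)
    obtain ⟨q', hq', hr⟩ := h r (Finset.mem_insert_self _ _)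
    refine ⟨q' * q, by positivity, fun r' hr' c i => ?_⟩
    rcases Finset.mem_insert.1 hr' with rfl | hmem
    · rw [show c * (q' * q) = c * q * q' by ring, hmul _ _ hr]
    · rw [← mul_assoc, hs r' hmem]

/-- If few patterns arise when a shape `S` is extended by a segment, two configurations agreeing
below a row that agree on a translate of the segment agree on a half row. -/
lemma eq_on_half_row {A : Type*} [Finite A] {X : Set (ℤ × ℤ → A)} (hX : Invariant X)
    (S : Finset (ℤ × ℤ)) (b o σ : ℤ) (k : ℕ) (hS : ∀ p ∈ S, p.2 < b)
    (hcount : (window (fun (x : ℤ × ℤ → A) (p : S) => x p) (fun x i => x (o + σ * i, b)) k ''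
      X).ncard < ((fun (x : ℤ × ℤ → A) (p : S) => x p) '' X).ncard + k)
    {x y : ℤ × ℤ → A} (hx : x ∈ X) (hy : y ∈ X) (hxy : ∀ p : ℤ × ℤ, p.2 < b → x p = y p) (m : ℤ)
    (hm : ∀ i : ℕ, i < k → x (o + m + σ * i, b) = y (o + m + σ * i, b)) (i : ℕ) :
    x (o + m + σ * i, b) = y (o + m + σ * i, b) := by
  obtain ⟨j, hj, hdet⟩ := exists_determined_letter _ _ _ _ hcount
  induction i using Nat.strong_induction_on with
  | _ i ih =>
    by_cases hik : i < k
    · exact hm i hik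
    · obtain ⟨e, rfl⟩ : ∃ e, i = e + j := ⟨i - j, by omega⟩
      have key : ∀ i : ℤ, ((o + σ * i, b) : ℤ × ℤ) + (m + σ * e, 0) = (o + m + σ * (e + i), b) := by
        intro i
        ext
        · simp
          ring
        · simp
      have := hdet _ (hX x hx (m + σ * e, 0)) _ (hX y hy (m + σ * e, 0))
        (funext fun p => hxy _ (by simpa using hS p p.2)) (fun i hi => by
          simp only [shift, key]
          have := ih (e + i) (by omega)
          push_cast at this
          exact this)
      simp only [shift, key] at this
      push_cast
      exact this

lemma hasPeriodic_of_balanced {A : Type*} [Finite A] (val : A → ℤ) (hval : Function.Injective val)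
    {X : Set (ℤ × ℤ → A)} (hX : Invariant X) (l : List (ℤ × ℤ)) (hl : ∀ u ∈ l, u ≠ 0)
    (hann : ∀ x ∈ X, diffs l (val ∘ x) = 0) (S : Finset (ℤ × ℤ)) (a b o : ℤ) (k : ℕ)
    (hS : ∀ p ∈ S, a ≤ p.2 ∧ p.2 < b)
    (hwide : ∀ r, a ≤ r → r < b → ∃ i : ℤ, ∀ s : ℕ, s + 1 < k → (i + s, r) ∈ S)
    (hcount : (window (fun (x : ℤ × ℤ → A) (p : S) => x p) (fun x i => x (o + i, b)) k ''
      X).ncard < ((fun (x : ℤ × ℤ → A) (p : S) => x p) '' X).ncard + k)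
    {x y : ℤ × ℤ → A} (hx : x ∈ X) (hy : y ∈ X) (hxy : ∀ p : ℤ × ℤ, p.2 < b → x p = y p)
    (j₀ : ℤ) (hne : x (j₀, b) ≠ y (j₀, b)) : HasPeriodic X := by
  set h : (ℤ × ℤ → A) → (S → A) := fun x p => x p with hh
  obtain ⟨_, hk, -⟩ := exists_determined_letter _ _ _ _ hcount
  -- the two configurations differ on every translate of the segment
  have hdiff : ∀ m : ℤ, ∃ i : ℕ, i < k ∧ x (o + i + m, b) ≠ y (o + i + m, b) := by
    intro m
    by_contra! hall
    apply hne
    rcases le_total (o + m) j₀ with hle | hle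
    · have := eq_on_half_row hX S b o 1 k (fun p hp => (hS p hp).2) (by simpa using hcount) hx hy
        hxy m (fun i hi => by
          have := hall i hi
          rw [add_right_comm] at this
          rwa [one_mul]) (j₀ - (o + m)).toNat
      rw [Int.toNat_of_nonneg (by linarith)] at this
      simpa using this
    · have hcount' : (window h (fun x i => x (o + k - 1 + -1 * i, b)) k '' X).ncard <
          (h '' X).ncard + k := by
        refine lt_of_le_of_lt ?_ hcount
        have : window h (fun x i => x (o + k - 1 + -1 * i, b)) k '' X =
            (fun f : (S → A) × (Fin k → A) => (f.1, fun i => f.2 i.rev)) ''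
              (window h (fun x i => x (o + i, b)) k '' X) := by
          rw [Set.image_image]
          refine Set.image_congr fun x _ => ?_
          simp only [window, Prod.mk.injEq, true_and]
          funext i
          congr 2
          rw [Fin.val_rev]
          have := i.2
          omega
        rw [this]
        exact Set.ncard_image_le (Set.toFinite _)
      have := eq_on_half_row hX S b (o + k - 1) (-1) k (fun p hp => (hS p hp).2) hcount' hx hy
        hxy m (fun i hi => by
          have := hall (k - 1 - i) (by omega)
          have e : o + k - 1 + m + -1 * (i : ℤ) = o + ((k - 1 - i : ℕ) : ℤ) + m := by omega
          rw [e]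
          exact this) (o + k - 1 + m - j₀).toNat
      rw [Int.toNat_of_nonneg (by omega)] at this
      have e : o + k - 1 + m + -1 * (o + k - 1 + m - j₀) = j₀ := by ring
      rwa [e] at this
  -- hence few patterns occur along the strip
  have hW := ncard_add_ncard_le_of_ambiguous X (window h (fun x i => x (o + i, b)) k) Prod.fst
    (Set.toFinite _) (Set.range fun m : ℤ => h (shift (m, 0) x)) (by
      rintro _ ⟨m, rfl⟩
      obtain ⟨i, hi, hne⟩ := hdiff m
      refine ⟨_, hX x hx (m, 0), _, hX y hy (m, 0), rfl, ?_, ?_⟩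
      · funext p
        exact (hxy _ (by simpa using (hS p p.2).2)).symm
      · intro heq
        have := congrFun (congrArg Prod.snd heq) ⟨i, hi⟩
        apply hne
        simpa [window, shift] using this)
  have hW0 : 0 < (Set.range fun m : ℤ => h (shift (m, 0) x)).ncard :=
    (Set.ncard_pos (Set.toFinite _)).2 (Set.range_nonempty _)
  have hWk : (Set.range fun m : ℤ => h (shift (m, 0) x)).ncard < k := by
    change (h '' X).ncard + _ ≤ _ at hW
    omega
  choose! c hc using hwide
  have hstrip : ∃ q : ℤ, 0 < q ∧ ∀ m : ℤ, (fun r : Set.Ico a b => x (c r + (m + q), r)) =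
      fun r : Set.Ico a b => x (c r + m, r) := by
    refine exists_period_of_window_count (fun _ => ()) (fun m (r : Set.Ico a b) => x (c r + m, r))
      1 one_pos (fun _ => rfl) (k - 1) ?_
    have hr : (Set.range fun _ : ℤ => ()).ncard = 1 := by
      rw [Set.range_const, Set.ncard_singleton]
    rw [hr]
    have : Set.range (window (fun _ : ℤ => ()) (fun (m : ℤ) (i : ℕ) (r : Set.Ico a b) =>
        x (c r + (m + i), r)) (k - 1)) = (fun f : S → A => ((), fun (i : Fin (k - 1))
          (r : Set.Ico a b) => f ⟨(c r + (i : ℕ), r), hc r r.2.1 r.2.2 i (by omega)⟩)) ''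
          (Set.range fun m : ℤ => h (shift (m, 0) x)) := by
      rw [← Set.range_comp]
      congr 1
      funext m
      simp only [window, Function.comp_apply, hh, shift, Prod.mk.injEq, true_and]
      funext i r
      congr 1
      ext <;> simp; ring
    rw [this]
    have := Set.ncard_image_le (f := (fun f : S → A => ((), fun (i : Fin (k - 1))
          (r : Set.Ico a b) => f ⟨(c r + (i : ℕ), r), hc r r.2.1 r.2.2 i (by omega)⟩)))
          (Set.toFinite (Set.range fun m : ℤ => h (shift (m, 0) x)))
    omega
  have hrows : ∀ n : ℕ, ∃ q : ℤ, 0 < q ∧ ∀ i, x (i + q, a + n) = x (i, a + n) := by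
    intro n
    induction n using Nat.strong_induction_on with
    | _ n ih =>
      by_cases hn : a + n < b
      · obtain ⟨q, hq, hstrip⟩ := hstrip
        refine ⟨q, hq, fun i => ?_⟩
        have := congrFun (hstrip (i - c (a + n))) ⟨a + n, by omega, hn⟩
        simp only at this
        ring_nf at this ⊢
        exact this
      · obtain ⟨q, hq, hper⟩ := exists_common_period x (Finset.Ico (a + n - (b - a)) (a + n))
          (fun r hr => by
            rw [Finset.mem_Ico] at hr
            have := ih (r - a).toNat (by omega)
            rwa [Int.toNat_of_nonneg (by omega), add_sub_cancel] at this)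
        obtain ⟨q', hq', hper'⟩ := exists_period_of_window_count
          (fun m => h (shift (m, a + n - b) x)) (fun m => x (o + m, a + n)) q hq (fun m => by
            funext p
            obtain ⟨⟨i, r⟩, hp⟩ := p
            have h1 := hS _ hp
            simp only [hh, shift, Prod.mk_add_mk]
            have := hper (r + (a + n - b)) (by rw [Finset.mem_Ico]; omega) 1 (i + m)
            rw [one_mul, add_assoc] at this
            exact this) k (by
            have hsub : Set.range (fun m : ℤ => shift (m, a + n - b) x) ⊆ X := by
              rintro _ ⟨m, rfl⟩
              exact hX x hx _
            have h1 := ncard_image_add_le_of_subset hsub (window h (fun x i => x (o + i, b)) k)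
              Prod.fst (Set.toFinite _)
            change _ + (h '' X).ncard ≤ _ + (h '' _).ncard at h1
            rw [← Set.range_comp, ← Set.range_comp] at h1
            have h2 : window h (fun x i => x (o + i, b)) k ∘ (fun m : ℤ => shift (m, a + n - b) x) =
                window (fun m => h (shift (m, a + n - b) x))
                  (fun (m : ℤ) (i : ℕ) => x (o + (m + i), a + n)) k := by
              funext m
              simp only [window, Function.comp_apply, shift, Prod.mk.injEq, true_and]
              funext i
              congr 1
              ext <;> simp; ring
            rw [h2] at h1
            change _ + _ ≤ _ + (Set.range fun m : ℤ => h (shift (m, a + n - b) x)).ncard at h1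
            omega)
        refine ⟨q', hq', fun i => ?_⟩
        have := hper' (i - o)
        ring_nf at this ⊢
        exact this
  obtain ⟨l', hl', V, hV, hper⟩ := exists_diffs_horizontally_periodic l hl
  obtain ⟨q, hq, hqper⟩ := exists_common_period x
    (Finset.Ico a (a + (l'.map fun u => |u.2|).sum)) (fun r hr => by
      rw [Finset.mem_Ico] at hr
      have := hrows (r - a).toNat
      rwa [Int.toNat_of_nonneg (by omega), add_sub_cancel] at this)
  have hzero : diff (q • (V, 0)) (val ∘ x) = 0 := by
    refine eq_zero_of_diffs_of_strip l' hl' _ a _ le_rfl (fun p h1 h2 => ?_) ?_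
    · obtain ⟨i, r⟩ := p
      have := hqper r (by rw [Finset.mem_Ico]; exact ⟨h1, h2⟩) (-V) i
      simp only [diff, Function.comp_apply, Prod.smul_mk, smul_eq_mul, mul_zero, Prod.mk_sub_mk,
        sub_zero]
      rw [← this, sub_eq_zero]
      congr 3
      ring
    · rw [diffs_diff]
      exact diff_zsmul_eq_zero (hper _ (bdd_comp val x) (hann x hx)) q
  refine ⟨x, hx, q • (V, 0), ?_, fun p => hval (diff_eq_zero_iff.1 hzero p)⟩
  intro h0
  have := congrArg Prod.fst h0
  simp at this
  omega

open Filter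

/-- Compactness: ultrafilter limits exist in closed sets of configurations. -/
lemma exists_limit {A : Type*} [Finite A] [TopologicalSpace A] [DiscreteTopology A]
    {X : Set (ℤ × ℤ → A)} (hX : IsClosed X) {ι : Type*} (U : Ultrafilter ι)
    (u : ι → ℤ × ℤ → A) (hu : ∀ i, u i ∈ X) :
    ∃ z ∈ X, ∀ p, ∀ᶠ i in (U : Filter ι), u i p = z p := by
  obtain ⟨z, -, hz⟩ := isCompact_univ.ultrafilter_le_nhds (U.map u) (by simp)
  have hz' : Tendsto u U (nhds z) := hz
  refine ⟨z, hX.mem_of_tendsto hz' (Eventually.of_forall hu), fun p => ?_⟩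
  have := tendsto_pi_nhds.1 hz' p
  rw [nhds_discrete, tendsto_pure] at this
  exact this

/-- Every configuration of the set has every configuration of the set in its orbit closure. -/
def OrbitsDense {A : Type*} (X : Set (ℤ × ℤ → A)) : Prop :=
  ∀ x ∈ X, ∀ y ∈ X, ∀ E : Finset (ℤ × ℤ), ∃ t, ∀ p ∈ E, x (p + t) = y p

/-- The set contains two configurations agreeing below the origin's row, but not at the origin. -/
def UpPair {A : Type*} (X : Set (ℤ × ℤ → A)) : Prop :=
  ∃ x ∈ X, ∃ y ∈ X, (∀ p : ℤ × ℤ, p.2 < 0 → x p = y p) ∧ x 0 ≠ y 0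

/-- The set contains two configurations agreeing above the origin's row, but not at the origin. -/
def DownPair {A : Type*} (X : Set (ℤ × ℤ → A)) : Prop :=
  ∃ x ∈ X, ∃ y ∈ X, (∀ p : ℤ × ℤ, 0 < p.2 → x p = y p) ∧ x 0 ≠ y 0

section

variable {A : Type*} [Finite A] [TopologicalSpace A] [DiscreteTopology A]

lemma exists_recurrence_ultrafilter {X : Set (ℤ × ℤ → A)} (hcl : IsClosed X) (hX : Invariant X)
    (hmin : OrbitsDense X) {x : ℤ × ℤ → A} (hx : x ∈ X) :
    ∃ U : Ultrafilter (ℤ × ℤ), (∀ R : ℤ, ∀ᶠ s in (U : Filter (ℤ × ℤ)), R ≤ s.2) ∧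
      ∀ p, ∀ᶠ s in (U : Filter (ℤ × ℤ)), x (p + s) = x p := by
  have key : ∀ e : Finset (ℤ × ℤ) × ℤ, ∃ s : ℤ × ℤ, e.2 ≤ s.2 ∧ ∀ p ∈ e.1, x (p + s) = x p := by
    rintro ⟨E, R⟩
    have hne : (comap (Prod.snd : ℤ × ℤ → ℤ) atTop).NeBot :=
      comap_neBot_iff.2 fun t ht => by
        obtain ⟨a, ha⟩ := (mem_atTop_sets.1 ht)
        exact ⟨(0, a), ha a le_rfl⟩
    obtain ⟨z, hz, hlim⟩ := exists_limit hcl (Ultrafilter.of (comap (Prod.snd : ℤ × ℤ → ℤ) atTop))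
      (fun s => shift s x) (fun s => hX x hx s)
    obtain ⟨t, ht⟩ := hmin z hz x hx E
    have h1 : ∀ᶠ s in (Ultrafilter.of (comap (Prod.snd : ℤ × ℤ → ℤ) atTop) : Filter (ℤ × ℤ)),
        ∀ p ∈ E, shift s x (p + t) = z (p + t) :=
      (eventually_all_finset E).2 fun p _ => hlim (p + t)
    have h2 : ∀ᶠ s in (Ultrafilter.of (comap (Prod.snd : ℤ × ℤ → ℤ) atTop) : Filter (ℤ × ℤ)),
        R - t.2 ≤ s.2 :=
      Ultrafilter.of_le _ (tendsto_comap.eventually (eventually_ge_atTop (R - t.2)))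
    obtain ⟨s, hs1, hs2⟩ := (h1.and h2).exists
    refine ⟨t + s, by simpa [add_comm] using hs2, fun p hp => ?_⟩
    rw [← add_assoc, ← ht p hp, ← hs1 p hp]
    rfl
  choose s hs1 hs2 using key
  refine ⟨(Ultrafilter.of (atTop : Filter (Finset (ℤ × ℤ) × ℤ))).map s, fun R => ?_, fun p => ?_⟩
  · have : ∀ᶠ e in ((Ultrafilter.of atTop : Ultrafilter (Finset (ℤ × ℤ) × ℤ)) : Filter _),
        R ≤ (s e).2 :=
      Ultrafilter.of_le _ ((eventually_ge_atTop (∅, R)).mono fun e he =>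
        (Prod.le_def.1 he).2.trans (hs1 e))
    exact this
  · have : ∀ᶠ e in ((Ultrafilter.of atTop : Ultrafilter (Finset (ℤ × ℤ) × ℤ)) : Filter _),
        x (p + s e) = x p :=
      Ultrafilter.of_le _ ((eventually_ge_atTop ({p}, 0)).mono fun e he =>
        hs2 e p ((Prod.le_def.1 he).1 (by simp)))
    exact this

lemma exists_thickness {X : Set (ℤ × ℤ → A)} (hcl : IsClosed X) (hX : Invariant X)
    (hdown : ¬ DownPair X) : ∃ h : ℕ, ∀ x ∈ X, ∀ y ∈ X, ∀ r : ℤ,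
      (∀ p : ℤ × ℤ, r < p.2 → p.2 ≤ r + h → x p = y p) → ∀ p : ℤ × ℤ, p.2 ≤ r + h → x p = y p := by
  have h1 : ∃ h : ℕ, ∀ x ∈ X, ∀ y ∈ X,
      (∀ p : ℤ × ℤ, 0 < p.2 → p.2 ≤ h → x p = y p) → x 0 = y 0 := by
    by_contra! hall
    choose x hx y hy hxy hne using hall
    obtain ⟨x', hx', hxlim⟩ := exists_limit hcl (hyperfilter ℕ) x hx
    obtain ⟨y', hy', hylim⟩ := exists_limit hcl (hyperfilter ℕ) y hy
    refine hdown ⟨x', hx', y', hy', fun p hp => ?_, ?_⟩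
    · have : ∀ᶠ h in (hyperfilter ℕ : Filter ℕ), p.2.toNat ≤ h :=
        Nat.hyperfilter_le_atTop (eventually_ge_atTop _)
      obtain ⟨h, h1, h2, h3⟩ := ((hxlim p).and ((hylim p).and this)).exists
      rw [← h1, ← h2, hxy h p hp (by omega)]
    · obtain ⟨h, h1, h2⟩ := ((hxlim 0).and (hylim 0)).exists
      rw [← h1, ← h2]
      exact hne h
  obtain ⟨h, hh⟩ := h1
  refine ⟨h, fun x hx y hy r hr => ?_⟩
  have h2 : ∀ n : ℕ, ∀ p : ℤ × ℤ, r - n < p.2 → p.2 ≤ r + h → x p = y p := by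
    intro n
    induction n with
    | zero => simpa using hr
    | succ n ih =>
      intro p hp1 hp2
      by_cases hp : r - n < p.2
      · exact ih p hp hp2
      · have := hh _ (hX x hx p) _ (hX y hy p) (fun q hq1 hq2 => ih _
          (by simp only [Prod.snd_add]; omega) (by simp only [Prod.snd_add]; omega))
        simpa [shift] using this
  exact fun p hp => h2 (r - p.2 + 1).toNat p (by omega) hp

/-- In a minimal set annihilated by differences, nondeterminism upwards forces nondeterminism
downwards. -/
lemma UpPair.downPair (val : A → ℤ) (hval : Function.Injective val)
    {X : Set (ℤ × ℤ → A)} (hcl : IsClosed X) (hX : Invariant X) (hmin : OrbitsDense X)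
    (l : List (ℤ × ℤ)) (hl : ∀ u ∈ l, u ≠ 0) (hann : ∀ x ∈ X, diffs l (val ∘ x) = 0)
    (hup : UpPair X) : DownPair X := by
  by_contra hdown
  obtain ⟨h, hh⟩ := exists_thickness hcl hX hdown
  obtain ⟨x, hx, y, hy, hxy, hne⟩ := hup
  obtain ⟨l', hl', V, hV, hper⟩ := exists_diffs_horizontally_periodic l hl
  obtain ⟨U, hUup, hUx⟩ := exists_recurrence_ultrafilter hcl hX hmin hx
  have hlim : ∀ z : ℤ × ℤ → A, ∃ z', z ∈ X → z' ∈ X ∧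
      ∀ p, ∀ᶠ s in (U : Filter (ℤ × ℤ)), z (p + s) = z' p := by
    intro z
    by_cases hz : z ∈ X
    · obtain ⟨z', hz'⟩ := exists_limit hcl U (fun s => shift s z) (fun s => hX z hz s)
      exact ⟨z', fun _ => hz'⟩
    · exact ⟨z, fun h => absurd h hz⟩
  choose L hL using hlim
  have hLx : L x = x := by
    funext p
    obtain ⟨s, h1, h2⟩ := ((hUx p).and ((hL x hx).2 p)).exists
    rw [← h2, h1]
  -- the fiber: configurations whose difference with `x` is `V`-periodic
  set F : Set (ℤ × ℤ → A) := {z | z ∈ X ∧ diff (V, 0) (val ∘ z - val ∘ x) = 0} with hF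
  have hxF : x ∈ F := ⟨hx, by rw [sub_self, diff_zero]⟩
  have hyF : y ∈ F := by
    refine ⟨hy, eq_zero_of_diffs_of_strip l' hl' _ (-(l'.map fun u => |u.2|).sum) _ le_rfl
      (fun p _ h2 => ?_) ?_⟩
    · rw [neg_add_cancel] at h2
      have h3 : (p - (V, 0)).2 < 0 := by simpa using h2
      simp [diff, hxy p h2, hxy _ h3]
    · rw [diffs_diff]
      refine hper _ ((bdd_comp val y).sub (bdd_comp val x)) ?_
      rw [diffs_sub, hann x hx, hann y hy, sub_zero]
  have hLF : Set.MapsTo L F F := by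
    rintro z ⟨hz, hzV⟩
    refine ⟨(hL z hz).1, diff_eq_zero_iff.2 fun p => ?_⟩
    obtain ⟨s, ⟨h1, h2⟩, h3, h4⟩ := ((((hL z hz).2 p).and ((hL z hz).2 (p + (V, 0)))).and
      ((hUx p).and (hUx (p + (V, 0))))).exists
    have h5 := diff_eq_zero_iff.1 hzV (p + s)
    simp only [Pi.sub_apply, Function.comp_apply] at h5 ⊢
    rw [← h1, ← h2, ← h3, ← h4, add_right_comm p (V, 0) s]
    exact h5
  have key : ∀ y₁ ∈ F, ∀ y₂ ∈ F, y₁ ≠ y₂ → ∀ r : ℤ,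
      ∃ p ∈ Finset.Ico (0 : ℤ) V ×ˢ Finset.Ioc r (r + h), L y₁ p ≠ L y₂ p := by
    rintro y₁ ⟨hy₁, hp₁⟩ y₂ ⟨hy₂, hp₂⟩ hne r
    by_contra! hall
    obtain ⟨p₀, hp₀⟩ := Function.ne_iff.1 hne
    have h1 : ∀ᶠ s in (U : Filter (ℤ × ℤ)), ∀ p ∈ Finset.Ico (0 : ℤ) V ×ˢ Finset.Ioc r (r + h),
        y₁ (p + s) = y₂ (p + s) := by
      refine (eventually_all_finset _).2 fun p hp => ?_
      filter_upwards [(hL y₁ hy₁).2 p, (hL y₂ hy₂).2 p] with s h1 h2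
      rw [h1, h2, hall p hp]
    obtain ⟨s, h1, h2⟩ := (h1.and (hUup (p₀.2 - r - h))).exists
    refine hp₀ (hh y₁ hy₁ y₂ hy₂ (r + s.2) (fun p hp hp' => hval ?_) p₀ (by omega))
    have h3 : ∀ q, (val ∘ y₁ - val ∘ y₂) (q + (V, 0)) = (val ∘ y₁ - val ∘ y₂) q := by
      intro q
      have e1 := diff_eq_zero_iff.1 hp₁ q
      have e2 := diff_eq_zero_iff.1 hp₂ q
      simp only [Pi.sub_apply] at e1 e2 ⊢
      linarith
    have h4 := apply_add_zsmul h3 (-((p.1 - s.1) / V)) p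
    have h5 : p + (-((p.1 - s.1) / V)) • (V, 0) = ((p.1 - s.1) % V, p.2 - s.2) + s := by
      have := Int.mul_ediv_add_emod (p.1 - s.1) V
      ext
      · simp only [Prod.fst_add, Prod.smul_mk, smul_eq_mul]
        linarith
      · simp
    rw [h5] at h4
    have h6 := h1 ((p.1 - s.1) % V, p.2 - s.2) (by
      simp only [Finset.mem_product, Finset.mem_Ico, Finset.mem_Ioc]
      exact ⟨⟨Int.emod_nonneg _ hV.ne', Int.emod_lt_of_pos _ hV⟩, by omega, by omega⟩)
    simp only [Pi.sub_apply, Function.comp_apply, h6, sub_self] at h4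
    linarith
  have hinj : Set.InjOn L F := by
    intro y₁ h₁ y₂ h₂ heq
    by_contra hne
    obtain ⟨p, -, hp⟩ := key y₁ h₁ y₂ h₂ hne 0
    exact hp (by rw [heq])
  have hfin : F.Finite := by
    refine Set.Finite.of_injOn (t := Set.univ)
      (f := fun z (p : Finset.Ico (0 : ℤ) V ×ˢ Finset.Ioc (0 : ℤ) (0 + h)) => L z p)
      (fun _ _ => Set.mem_univ _) ?_ Set.finite_univ
    intro y₁ h₁ y₂ h₂ heq
    by_contra hne
    obtain ⟨p, hp, hp'⟩ := key y₁ h₁ y₂ h₂ hne 0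
    exact hp' (congrFun heq ⟨p, hp⟩)
  obtain ⟨y', hy', rfl⟩ := ((hfin.injOn_iff_bijOn_of_mapsTo hLF).1 hinj).surjOn hyF
  obtain ⟨p, hp, hp'⟩ := key y' hy' x hxF (by rintro rfl; exact hne (by rw [hLx])) (-h - 1)
  rw [hLx] at hp'
  simp only [Finset.mem_product, Finset.mem_Ioc] at hp
  exact hp' (hxy p (by omega)).symm

end

lemma exists_pair_agreeing_on_disc {A : Type*} [Finite A] {X : Set (ℤ × ℤ → A)}
    (hX : Invariant X) (hne : X.Nonempty) (hper : ¬ HasPeriodic X) (N : ℕ) :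
    ∃ x ∈ X, ∃ y ∈ X, ∃ q : ℤ × ℤ, ((N : ℤ) < |q.1| ∨ N < |q.2|) ∧ x 0 ≠ y 0 ∧
      ∀ p : ℤ × ℤ, p.1 ^ 2 + p.2 ^ 2 + 2 * (p.1 * q.1 + p.2 * q.2) < 0 → x p = y p := by
  obtain ⟨x₀, hx₀⟩ := hne
  obtain ⟨s, t, hst, heq⟩ := Finite.exists_ne_map_eq_of_infinite
    (fun (t : ℤ × ℤ) (p : (Finset.Icc (-N : ℤ) N ×ˢ Finset.Icc (-N : ℤ) N)) => shift t x₀ p)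
  have hdiff : ∃ p, shift s x₀ p ≠ shift t x₀ p := by
    by_contra! hall
    refine hper ⟨x₀, hx₀, s - t, sub_ne_zero.2 hst, fun p => ?_⟩
    have := hall (p - t)
    simpa [shift, sub_add_eq_add_sub, add_sub_assoc] using this
  obtain ⟨q, hq, hmin⟩ := WellFounded.has_min
    (measure fun p : ℤ × ℤ => (p.1 ^ 2 + p.2 ^ 2).toNat).wf {p | shift s x₀ p ≠ shift t x₀ p} hdiff
  refine ⟨_, hX _ (hX x₀ hx₀ s) q, _, hX _ (hX x₀ hx₀ t) q, q, ?_, ?_, fun p hp => ?_⟩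
  · by_contra! hcon
    refine hq (congrFun heq ⟨q, ?_⟩)
    simp only [Finset.mem_product, Finset.mem_Icc]
    exact ⟨abs_le.1 hcon.1, abs_le.1 hcon.2⟩
  · simpa [shift] using hq
  · by_contra hcon
    refine hmin (p + q) hcon ?_
    have h1 : (p + q).1 ^ 2 + (p + q).2 ^ 2 < q.1 ^ 2 + q.2 ^ 2 := by
      simp only [Prod.fst_add, Prod.snd_add]
      nlinarith
    have h2 : 0 ≤ (p + q).1 ^ 2 + (p + q).2 ^ 2 := by positivity
    change ((p + q).1 ^ 2 + (p + q).2 ^ 2).toNat < (q.1 ^ 2 + q.2 ^ 2).toNat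
    omega

section

variable {A : Type*} [Finite A] [TopologicalSpace A] [DiscreteTopology A]

/-- A closed invariant set without periodic configurations is nondeterministic in some direction. -/
lemma exists_halfspace_pair {X : Set (ℤ × ℤ → A)} (hcl : IsClosed X) (hX : Invariant X)
    (hne : X.Nonempty) (hper : ¬ HasPeriodic X) : ∃ u : ℝ × ℝ, u ≠ 0 ∧ ∃ x ∈ X, ∃ y ∈ X,
      (∀ p : ℤ × ℤ, p.1 * u.1 + p.2 * u.2 < 0 → x p = y p) ∧ x 0 ≠ y 0 := by
  choose x hx y hy q hq hxy hag using exists_pair_agreeing_on_disc hX hne hper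
  set w : ℕ → ℝ × ℝ := fun N => ((q N).1, (q N).2) with hw
  have hwN : ∀ N : ℕ, (N : ℝ) < ‖w N‖ := by
    intro N
    rw [Prod.norm_def, lt_max_iff]
    simp only [hw, Real.norm_eq_abs]
    exact_mod_cast hq N
  have hw0 : ∀ N, 0 < ‖w N‖ := fun N => (Nat.cast_nonneg N).trans_lt (hwN N)
  obtain ⟨u, hu, hlim⟩ := (isCompact_sphere (0 : ℝ × ℝ) 1).ultrafilter_le_nhds
    ((hyperfilter ℕ).map fun N => ‖w N‖⁻¹ • w N) (by
      rw [le_principal_iff]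
      refine mem_map.2 (Eventually.of_forall fun N => ?_)
      rw [mem_sphere_zero_iff_norm, norm_smul, norm_inv, norm_norm, inv_mul_cancel₀ (hw0 N).ne'])
  have hlim' : Tendsto (fun N => ‖w N‖⁻¹ • w N) (hyperfilter ℕ : Filter ℕ) (nhds u) := hlim
  obtain ⟨x', hx', hxlim⟩ := exists_limit hcl (hyperfilter ℕ) x hx
  obtain ⟨y', hy', hylim⟩ := exists_limit hcl (hyperfilter ℕ) y hy
  refine ⟨u, ?_, x', hx', y', hy', fun p hp => ?_, ?_⟩
  · rintro rfl
    simp at hu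
  · have hinv : Tendsto (fun N => ‖w N‖⁻¹) (hyperfilter ℕ : Filter ℕ) (nhds 0) :=
      (tendsto_inv_atTop_zero.comp
        (tendsto_atTop_mono (fun N => (hwN N).le) tendsto_natCast_atTop_atTop)).mono_left
        Nat.hyperfilter_le_atTop
    have h1 : Tendsto (fun N => ((p.1 : ℝ) ^ 2 + p.2 ^ 2) * ‖w N‖⁻¹ +
        2 * (p.1 * (‖w N‖⁻¹ • w N).1 + p.2 * (‖w N‖⁻¹ • w N).2)) (hyperfilter ℕ : Filter ℕ)
        (nhds (((p.1 : ℝ) ^ 2 + p.2 ^ 2) * 0 + 2 * (p.1 * u.1 + p.2 * u.2))) :=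
      (hinv.const_mul _).add ((((continuous_fst.tendsto u).comp hlim').const_mul _).add
        (((continuous_snd.tendsto u).comp hlim').const_mul _) |>.const_mul 2)
    have h2 := h1.eventually_lt_const (show _ < (0 : ℝ) by linarith)
    obtain ⟨N, h3, h4, h5⟩ := ((hxlim p).and ((hylim p).and h2)).exists
    rw [← h3, ← h4]
    refine hag N p ?_
    have h6 : ((p.1 : ℝ) ^ 2 + p.2 ^ 2) * ‖w N‖⁻¹ +
        2 * (p.1 * (‖w N‖⁻¹ • w N).1 + p.2 * (‖w N‖⁻¹ • w N).2) =
        ‖w N‖⁻¹ * (p.1 ^ 2 + p.2 ^ 2 + 2 * (p.1 * (q N).1 + p.2 * (q N).2)) := by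
      simp only [hw, Prod.smul_mk, smul_eq_mul]
      ring
    rw [h6] at h5
    have h7 := neg_of_mul_neg_right h5 (inv_nonneg.2 (hw0 N).le)
    exact_mod_cast h7
  · obtain ⟨N, h1, h2⟩ := ((hxlim 0).and (hylim 0)).exists
    rw [← h1, ← h2]
    exact hxy N

end

/-- The number of patterns of shape `S` in the configurations of `X`. -/
noncomputable def complexity {A : Type*} (X : Set (ℤ × ℤ → A)) (S : Finset (ℤ × ℤ)) : ℕ :=
  ((fun (x : ℤ × ℤ → A) (p : S) => x p) '' X).ncard

/-- The configurations of `X` in the coordinates given by `M`. -/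
def reframe {A : Type*} (M : (ℤ × ℤ) ≃+ (ℤ × ℤ)) (X : Set (ℤ × ℤ → A)) : Set (ℤ × ℤ → A) :=
  {x | (fun p => x (M.symm p)) ∈ X}

section

variable {A : Type*} {X : Set (ℤ × ℤ → A)} (M : (ℤ × ℤ) ≃+ (ℤ × ℤ))

lemma comp_mem_reframe {x : ℤ × ℤ → A} (hx : x ∈ X) : (fun p => x (M p)) ∈ reframe M X := by
  simpa [reframe] using hx

lemma Invariant.reframe (hX : Invariant X) : Invariant (reframe M X) := by
  intro x hx t
  have := hX _ hx (M t)
  unfold shift at this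
  simpa [LowComplexity.reframe, shift] using this

lemma OrbitsDense.reframe (hX : OrbitsDense X) : OrbitsDense (reframe M X) := by
  intro x hx y hy E
  obtain ⟨t, ht⟩ := hX _ hx _ hy (E.map M.toEquiv.toEmbedding)
  refine ⟨M.symm t, fun p hp => ?_⟩
  simpa using ht (M p) (by simpa using hp)

lemma HasPeriodic.of_reframe (h : HasPeriodic (reframe M X)) : HasPeriodic X := by
  obtain ⟨x, hx, t, ht, h⟩ := h
  exact ⟨_, hx, M t, by simpa using ht, fun p => by simpa using h (M.symm p)⟩

lemma diffs_map_symm_eq_zero (val : A → ℤ) (l : List (ℤ × ℤ))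
    (hann : ∀ x ∈ X, diffs l (val ∘ x) = 0) :
    ∀ x ∈ reframe M X, diffs (l.map M.symm) (val ∘ x) = 0 := by
  intro x hx
  have h1 : val ∘ x = (val ∘ fun p => x (M.symm p)) ∘ M := by
    funext p
    simp
  have h2 : (l.map M.symm).map M = l := by simp [List.map_map]
  rw [h1, diffs_map_comp, h2, hann _ hx]
  rfl

lemma _root_.IsClosed.reframe [TopologicalSpace A] (hX : IsClosed X) :
    IsClosed (reframe M X) :=
  hX.preimage (continuous_pi fun _ => continuous_apply _)

variable [Finite A]

lemma complexity_le_of_forall_exists {X Y : Set (ℤ × ℤ → A)} {S T : Finset (ℤ × ℤ)}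
    (f : (T → A) → S → A) (h : ∀ x ∈ X, ∃ y ∈ Y, f (fun p : T => y p) = fun p : S => x p) :
    complexity X S ≤ complexity Y T := by
  refine (Set.ncard_le_ncard ?_ (Set.toFinite _)).trans
    (Set.ncard_image_le (f := f) (Set.toFinite _))
  rintro _ ⟨x, hx, rfl⟩
  obtain ⟨y, hy, hxy⟩ := h x hx
  exact ⟨_, ⟨y, hy, rfl⟩, hxy⟩

lemma complexity_reframe_le {S T : Finset (ℤ × ℤ)} (h : ∀ p ∈ S, M p ∈ T) :
    complexity (reframe M X) S ≤ complexity X T :=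
  complexity_le_of_forall_exists (fun g p => g ⟨M p, h p p.2⟩) fun x hx => ⟨_, hx, by simp⟩

lemma le_complexity_reframe {S T : Finset (ℤ × ℤ)} (h : ∀ p ∈ S, M.symm p ∈ T) :
    complexity X S ≤ complexity (reframe M X) T :=
  complexity_le_of_forall_exists (fun g p => g ⟨M.symm p, h p p.2⟩)
    fun x hx => ⟨_, comp_mem_reframe M hx, by simp⟩

end

/-- The reflection in the horizontal axis. -/
def rowFlip : (ℤ × ℤ) ≃+ (ℤ × ℤ) where
  toFun p := (p.1, -p.2)
  invFun p := (p.1, -p.2)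
  left_inv p := by simp
  right_inv p := by simp
  map_add' p q := by ext <;> simp [add_comm]

lemma DownPair.upPair {A : Type*} {X : Set (ℤ × ℤ → A)} (h : DownPair X) :
    UpPair (reframe rowFlip X) := by
  obtain ⟨x, hx, y, hy, hxy, hne⟩ := h
  refine ⟨_, comp_mem_reframe rowFlip hx, _, comp_mem_reframe rowFlip hy, fun p hp => hxy _ ?_,
    by simpa⟩
  change 0 < -p.2
  omega

/-- Nondeterminism in some direction becomes nondeterminism upwards in suitable coordinates. -/
lemma exists_reframe_upPair {A : Type*} (val : A → ℤ) (hval : Function.Injective val)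
    {X : Set (ℤ × ℤ → A)} (l : List (ℤ × ℤ)) (hl : ∀ u ∈ l, u ≠ 0)
    (hann : ∀ x ∈ X, diffs l (val ∘ x) = 0) {u : ℝ × ℝ} (hu : u ≠ 0) {x y : ℤ × ℤ → A}
    (hx : x ∈ X) (hy : y ∈ X)
    (hxy : ∀ p : ℤ × ℤ, p.1 * u.1 + p.2 * u.2 < 0 → x p = y p) (hne : x 0 ≠ y 0) :
    ∃ M, UpPair (reframe M X) := by
  let φ : ℤ × ℤ →+ ℝ :=
    { toFun := fun p => p.1 * u.1 + p.2 * u.2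
      map_zero' := by simp
      map_add' := fun p q => by
        simp only [Prod.fst_add, Prod.snd_add, Int.cast_add]
        ring }
  have hφ : ∀ p, φ p = p.1 * u.1 + p.2 * u.2 := fun p => rfl
  obtain ⟨v, hvl, hv⟩ : ∃ v ∈ l, φ v = 0 := by
    by_contra! hall
    have := congrFun (eq_zero_of_diffs_of_halfspace φ l hall (val ∘ x - val ∘ y)
      (fun p hp => by simp [hxy p hp]) (by rw [diffs_sub, hann x hx, hann y hy, sub_zero])) 0
    simp only [Pi.sub_apply, Function.comp_apply, Pi.zero_apply, sub_eq_zero] at this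
    exact hne (hval this)
  have key : ∃ a b α β : ℤ, a * α + b * β = 1 ∧ a * u.1 + b * u.2 = 0 ∧
      0 < -β * u.1 + α * u.2 := by
    have hg : 0 < Int.gcd v.1 v.2 := by
      refine Nat.pos_of_ne_zero fun h0 => hl v hvl ?_
      rw [Int.gcd_eq_zero_iff] at h0
      exact Prod.ext h0.1 h0.2
    obtain ⟨a, b, hab, hv1, hv2⟩ := Int.exists_gcd_one hg
    generalize Int.gcd v.1 v.2 = g at hg hv1 hv2
    obtain ⟨α, β, hαβ⟩ := Int.isCoprime_iff_gcd_eq_one.2 hab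
    have h1 : a * u.1 + b * u.2 = 0 := by
      rw [hφ, hv1, hv2] at hv
      push_cast at hv
      have h2 : (g : ℝ) ≠ 0 := by exact_mod_cast hg.ne'
      refine mul_right_cancel₀ h2 ?_
      linear_combination hv
    have h3 : (α * a + β * b : ℝ) = 1 := by exact_mod_cast hαβ
    have h2 : -β * u.1 + α * u.2 ≠ 0 := by
      intro h2
      refine hu (Prod.ext ?_ ?_)
      · simp only [Prod.fst_zero]
        linear_combination α * h1 - b * h2 - u.1 * h3
      · simp only [Prod.snd_zero]
        linear_combination β * h1 + a * h2 - u.2 * h3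
    rcases h2.lt_or_gt with h2 | h2
    · refine ⟨-a, -b, -α, -β, by linear_combination hαβ, ?_, ?_⟩
      · push_cast
        linear_combination -h1
      · push_cast
        linarith
    · exact ⟨a, b, α, β, by linear_combination hαβ, h1, h2⟩
  obtain ⟨a, b, α, β, h1, h2, h3⟩ := key
  let M : (ℤ × ℤ) ≃+ (ℤ × ℤ) :=
    { toFun := fun p => (a * p.1 - β * p.2, b * p.1 + α * p.2)
      invFun := fun p => (α * p.1 + β * p.2, -b * p.1 + a * p.2)
      left_inv := fun p => by
        ext
        · simp only
          linear_combination p.1 * h1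
        · simp only
          linear_combination p.2 * h1
      right_inv := fun p => by
        ext
        · simp only
          linear_combination p.1 * h1
        · simp only
          linear_combination p.2 * h1
      map_add' := fun p q => by
        ext
        · simp only [Prod.fst_add, Prod.snd_add]
          ring
        · simp only [Prod.fst_add, Prod.snd_add]
          ring }
  refine ⟨M, _, comp_mem_reframe M hx, _, comp_mem_reframe M hy, fun p hp => hxy _ ?_, by simpa⟩
  change ((a * p.1 - β * p.2 : ℤ) : ℝ) * u.1 + ((b * p.1 + α * p.2 : ℤ) : ℝ) * u.2 < 0
  have h4 : (p.2 : ℝ) < 0 := by exact_mod_cast hp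
  have h5 := mul_neg_of_neg_of_pos h4 h3
  push_cast
  linear_combination h5 + p.1 * h2

/-- The finite set contains every point not separated from it by an integral half plane. -/
def LatticeConvex (D : Finset (ℤ × ℤ)) : Prop :=
  ∀ p : ℤ × ℤ, (∀ α β γ : ℤ, (∀ q ∈ D, α * q.1 + β * q.2 ≤ γ) → α * p.1 + β * p.2 ≤ γ) → p ∈ D

lemma LatticeConvex.map {D : Finset (ℤ × ℤ)} (hD : LatticeConvex D) (M : (ℤ × ℤ) ≃+ (ℤ × ℤ)) :
    LatticeConvex (D.map M.toEquiv.toEmbedding) := by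
  intro p hp
  rw [Finset.mem_map_equiv]
  refine hD _ fun α β γ h => ?_
  have hN : ∀ q : ℤ × ℤ, α * (M.symm q).1 + β * (M.symm q).2 =
      (α * (M.symm (1, 0)).1 + β * (M.symm (1, 0)).2) * q.1 +
        (α * (M.symm (0, 1)).1 + β * (M.symm (0, 1)).2) * q.2 := by
    intro q
    have h1 : q = q.1 • (1, 0) + q.2 • (0, 1) := by ext <;> simp
    have h2 : M.symm q = q.1 • M.symm (1, 0) + q.2 • M.symm (0, 1) := by
      conv_lhs => rw [h1, map_add, map_zsmul, map_zsmul]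
    rw [h2]
    simp only [Prod.fst_add, Prod.snd_add, Prod.smul_fst, Prod.smul_snd, smul_eq_mul]
    ring
  refine (hN p).trans_le (hp _ _ _ fun q hq => ?_)
  rw [← hN]
  exact h _ (Finset.mem_map_equiv.1 hq)

lemma latticeConvex_Icc_product (a b c d : ℤ) :
    LatticeConvex (Finset.Icc a b ×ˢ Finset.Icc c d) := by
  intro p hp
  simp only [Finset.mem_product, Finset.mem_Icc] at hp ⊢
  have h1 := hp (-1) 0 (-a) fun q hq => by omega
  have h2 := hp 1 0 b fun q hq => by omega
  have h3 := hp 0 (-1) (-c) fun q hq => by omega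
  have h4 := hp 0 1 d fun q hq => by omega
  omega

lemma LatticeConvex.row {D : Finset (ℤ × ℤ)} (hD : LatticeConvex D) {r : ℤ}
    (hne : ∃ i, (i, r) ∈ D) :
    ∃ (o : ℤ) (k : ℕ), 0 < k ∧ ∀ i, (i, r) ∈ D ↔ o ≤ i ∧ i < o + k := by
  set R := (D.filter fun p => p.2 = r).image Prod.fst with hR
  have hmem : ∀ i, i ∈ R ↔ (i, r) ∈ D := by
    intro i
    simp only [hR, Finset.mem_image, Finset.mem_filter]
    constructor
    · rintro ⟨p, ⟨hp, rfl⟩, rfl⟩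
      exact hp
    · intro h
      exact ⟨_, ⟨h, rfl⟩, rfl⟩
  have hRne : R.Nonempty := hne.imp fun i hi => (hmem i).2 hi
  have hle := R.min'_le_max' hRne
  refine ⟨R.min' hRne, (R.max' hRne - R.min' hRne + 1).toNat, by omega, fun i => ⟨fun h => ?_, ?_⟩⟩
  · have h1 := R.min'_le i ((hmem i).2 h)
    have h2 := R.le_max' i ((hmem i).2 h)
    omega
  · rintro ⟨h1, h2⟩
    refine hD _ fun α β γ h => ?_
    have h3 := h _ ((hmem _).1 (R.min'_mem hRne))
    have h4 := h _ ((hmem _).1 (R.max'_mem hRne))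
    simp only at h3 h4 ⊢
    rcases le_total 0 α with hα | hα
    · nlinarith [mul_le_mul_of_nonneg_left (show i ≤ R.max' hRne by omega) hα]
    · nlinarith [mul_le_mul_of_nonpos_left h1 hα]

/-- If two rows contain `k` consecutive points, the rows in between contain `k - 1` consecutive
points. -/
lemma LatticeConvex.exists_interval {D : Finset (ℤ × ℤ)} (hD : LatticeConvex D) {a b i j : ℤ}
    {k : ℕ} (hi : ∀ s : ℕ, s < k → (i + s, a) ∈ D) (hj : ∀ s : ℕ, s < k → (j + s, b) ∈ D)
    {r : ℤ} (har : a ≤ r) (hrb : r < b) :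
    ∃ m : ℤ, ∀ s : ℕ, s + 1 < k → (m + s, r) ∈ D := by
  set w := (b - r) * i + (r - a) * j with hw
  refine ⟨-(-w / (b - a)), fun s hs => hD _ fun α β γ h => ?_⟩
  have h1 := Int.mul_ediv_add_emod (-w) (b - a)
  have h2 := Int.emod_nonneg (-w) (show b - a ≠ 0 by omega)
  have h3 := Int.emod_lt_of_pos (-w) (show 0 < b - a by omega)
  generalize -w / (b - a) = e at *
  generalize -w % (b - a) = ρ at *
  have hi0 := h _ (hi s (by omega))
  have hi1 := h _ (hi (s + 1) hs)
  have hj0 := h _ (hj s (by omega))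
  have hj1 := h _ (hj (s + 1) hs)
  simp only [Nat.cast_add, Nat.cast_one] at hi0 hi1 hj0 hj1 ⊢
  have hra : 0 ≤ r - a := by omega
  have hbr : 0 ≤ b - r := by omega
  refine le_of_mul_le_mul_left (a := b - a) ?_ (by omega)
  have h4 : (b - a) * (α * (-e + s) + β * r) = (b - r) * (α * (i + s) + β * a) +
      (r - a) * (α * (j + s) + β * b) + α * ρ := by
    rw [hw] at h1
    linear_combination -α * h1
  rw [h4]
  rcases le_total 0 α with hα | hα
  · have := mul_le_mul_of_nonneg_left h3.le hα
    linarith [mul_le_mul_of_nonneg_left hi1 hbr, mul_le_mul_of_nonneg_left hj1 hra]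
  · have := mul_nonpos_of_nonpos_of_nonneg hα h2
    linarith [mul_le_mul_of_nonneg_left hi0 hbr, mul_le_mul_of_nonneg_left hj0 hra]

/-- The points of `D` in the rows from `a` to `b`. -/
def strip (D : Finset (ℤ × ℤ)) (a b : ℤ) : Finset (ℤ × ℤ) := D.filter fun p => a ≤ p.2 ∧ p.2 ≤ b

lemma mem_strip {D : Finset (ℤ × ℤ)} {a b : ℤ} {p : ℤ × ℤ} :
    p ∈ strip D a b ↔ p ∈ D ∧ a ≤ p.2 ∧ p.2 ≤ b := Finset.mem_filter

lemma card_filter_row {D : Finset (ℤ × ℤ)} {r o : ℤ} {k : ℕ}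
    (h : ∀ i, (i, r) ∈ D ↔ o ≤ i ∧ i < o + k) : (D.filter fun p => p.2 = r).card = k := by
  have : D.filter (fun p => p.2 = r) =
      (Finset.Ico o (o + k)).map ⟨fun i => (i, r), fun i j hij => (Prod.mk.inj hij).1⟩ := by
    ext ⟨i, s⟩
    simp only [Finset.mem_filter, Finset.mem_map, Finset.mem_Ico]
    constructor
    · rintro ⟨h1, rfl⟩
      exact ⟨i, (h i).1 h1, rfl⟩
    · rintro ⟨j, h1, h2⟩
      obtain ⟨rfl, rfl⟩ := Prod.mk.inj h2
      exact ⟨(h j).2 h1, rfl⟩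
  simp [this]

section

variable {A : Type*} [Finite A]

/-- A shape of low complexity contains a strip both of whose edges add few patterns. -/
lemma exists_strip {X : Set (ℤ × ℤ → A)} (hne : X.Nonempty) {D : Finset (ℤ × ℤ)}
    (hD : LatticeConvex D) (hlow : complexity X D ≤ D.card) :
    ∃ (a b o o' : ℤ) (k k' : ℕ), a ≤ b ∧ (∀ i, (i, a) ∈ D ↔ o ≤ i ∧ i < o + k) ∧
      (∀ i, (i, b) ∈ D ↔ o' ≤ i ∧ i < o' + k') ∧
      complexity X (strip D a b) < complexity X (strip D (a + 1) b) + k ∧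
      complexity X (strip D a b) < complexity X (strip D a (b - 1)) + k' := by
  classical
  have hex : ∃ N a b, complexity X (strip D a b) ≤ (strip D a b).card ∧
      (strip D a b).card = N := by
    obtain ⟨a, ha⟩ := (D.image Prod.snd).finite_toSet.bddBelow
    obtain ⟨b, hb⟩ := (D.image Prod.snd).finite_toSet.bddAbove
    have : strip D a b = D := Finset.filter_true_of_mem fun p hp =>
      ⟨ha (by simpa using ⟨_, hp⟩), hb (by simpa using ⟨_, hp⟩)⟩
    exact ⟨_, a, b, by rwa [this], rfl⟩
  obtain ⟨a, b, h1, h2⟩ := Nat.find_spec hex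
  have hmin : ∀ a' b', (strip D a' b').card < (strip D a b).card →
      (strip D a' b').card < complexity X (strip D a' b') := by
    intro a' b' hlt
    by_contra! hcon
    exact Nat.find_min hex (h2 ▸ hlt) ⟨a', b', hcon, rfl⟩
  have hSne : (strip D a b).Nonempty := by
    rw [← Finset.card_pos]
    refine lt_of_lt_of_le ?_ h1
    exact (Set.ncard_pos (Set.toFinite _)).2 (hne.image _)
  obtain ⟨p, hp, hpmin⟩ := (strip D a b).exists_min_image Prod.snd hSne
  obtain ⟨q, hq, hqmax⟩ := (strip D a b).exists_max_image Prod.snd hSne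
  have heq : strip D p.2 q.2 = strip D a b := by
    have h3 := mem_strip.1 hp
    have h4 := mem_strip.1 hq
    ext x
    refine ⟨fun hx => ?_, fun hx => ?_⟩
    · have := mem_strip.1 hx
      exact mem_strip.2 ⟨this.1, by omega, by omega⟩
    · exact mem_strip.2 ⟨(mem_strip.1 hx).1, hpmin x hx, hqmax x hx⟩
  rw [← heq] at hmin h1
  obtain ⟨o, k, hk, ho⟩ := hD.row ⟨p.1, (mem_strip.1 hp).1⟩
  obtain ⟨o', k', hk', ho'⟩ := hD.row ⟨q.1, (mem_strip.1 hq).1⟩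
  have hpq := hpmin q hq
  have hc1 : (strip D p.2 q.2).card = (strip D (p.2 + 1) q.2).card + k := by
    rw [← card_filter_row ho, ← Finset.card_union_of_disjoint]
    · congr 1
      ext x
      simp only [mem_strip, Finset.mem_union, Finset.mem_filter, ← and_or_left]
      refine and_congr_right fun _ => ?_
      omega
    · refine Finset.disjoint_left.2 fun x hx hx' => ?_
      have := (mem_strip.1 hx).2
      have := (Finset.mem_filter.1 hx').2
      omega
  have hc2 : (strip D p.2 q.2).card = (strip D p.2 (q.2 - 1)).card + k' := by
    rw [← card_filter_row ho', ← Finset.card_union_of_disjoint]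
    · congr 1
      ext x
      simp only [mem_strip, Finset.mem_union, Finset.mem_filter, ← and_or_left]
      refine and_congr_right fun _ => ?_
      omega
    · refine Finset.disjoint_left.2 fun x hx hx' => ?_
      have := (mem_strip.1 hx).2
      have := (Finset.mem_filter.1 hx').2
      omega
  have := hmin (p.2 + 1) q.2 (by omega)
  have := hmin p.2 (q.2 - 1) (by omega)
  exact ⟨p.2, q.2, o, o', k, k', hpq, ho, ho', by omega, by omega⟩

lemma UpPair.hasPeriodic_of_strip (val : A → ℤ) (hval : Function.Injective val)
    {X : Set (ℤ × ℤ → A)} (hX : Invariant X) (l : List (ℤ × ℤ)) (hl : ∀ u ∈ l, u ≠ 0)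
    (hann : ∀ x ∈ X, diffs l (val ∘ x) = 0) {D : Finset (ℤ × ℤ)} (hD : LatticeConvex D)
    {a b i o : ℤ} {k : ℕ} (hi : ∀ s : ℕ, s < k → (i + s, a) ∈ D)
    (ho : ∀ s : ℕ, s < k → (o + s, b) ∈ D) (hab : a ≤ b)
    (hcount : complexity X (strip D a b) < complexity X (strip D a (b - 1)) + k)
    (hup : UpPair X) : HasPeriodic X := by
  obtain ⟨x, hx, y, hy, hxy, hne⟩ := hup
  refine hasPeriodic_of_balanced val hval hX l hl hann (strip D a (b - 1)) a b o k
    (fun p hp => ?_) (fun r har hrb => ?_) (lt_of_le_of_lt ?_ hcount) (hX x hx (0, -b))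
    (hX y hy (0, -b)) (fun p hp => hxy _ ?_) 0 ?_
  · have := mem_strip.1 hp
    omega
  · obtain ⟨m, hm⟩ := hD.exists_interval hi ho har hrb
    refine ⟨m, fun s hs => mem_strip.2 ⟨hm s hs, har, ?_⟩⟩
    simp only
    omega
  · refine (Set.ncard_le_ncard ?_ (Set.toFinite _)).trans (Set.ncard_image_le
      (f := fun (g : strip D a b → A) =>
        ((fun p => g ⟨p, mem_strip.2 ⟨(mem_strip.1 p.2).1, (mem_strip.1 p.2).2.1,
          (mem_strip.1 p.2).2.2.trans (by omega)⟩⟩ : strip D a (b - 1) → A),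
        fun s : Fin k => g ⟨(o + s, b), mem_strip.2 ⟨ho s s.2, hab, le_rfl⟩⟩)) (Set.toFinite _))
    rintro _ ⟨x, hx, rfl⟩
    exact ⟨_, ⟨x, hx, rfl⟩, rfl⟩
  · simpa using hp
  · simpa [shift, ← Prod.zero_eq_mk] using hne

variable [TopologicalSpace A] [DiscreteTopology A]

lemma UpPair.hasPeriodic (val : A → ℤ) (hval : Function.Injective val)
    {X : Set (ℤ × ℤ → A)} (hcl : IsClosed X) (hX : Invariant X) (hmin : OrbitsDense X)
    (l : List (ℤ × ℤ)) (hl : ∀ u ∈ l, u ≠ 0) (hann : ∀ x ∈ X, diffs l (val ∘ x) = 0)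
    {D : Finset (ℤ × ℤ)} (hD : LatticeConvex D) (hlow : complexity X D ≤ D.card)
    (hup : UpPair X) : HasPeriodic X := by
  obtain ⟨a, b, o, o', k, k', hab, ho, ho', h1, h2⟩ :=
    exists_strip ⟨_, hup.choose_spec.1⟩ hD hlow
  rcases le_total k' k with hk | hk
  · exact hup.hasPeriodic_of_strip val hval hX l hl hann hD (i := o) (o := o') (k := k')
      (fun s hs => (ho _).2 (by omega)) (fun s hs => (ho' _).2 (by omega)) hab h2
  · have hflip : ∀ {p : ℤ × ℤ}, p ∈ D.map rowFlip.toEquiv.toEmbedding ↔ (p.1, -p.2) ∈ D :=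
      Finset.mem_map_equiv
    have hstrip : ∀ {p : ℤ × ℤ} {c d : ℤ}, p ∈ strip (D.map rowFlip.toEquiv.toEmbedding) c d ↔
        (p.1, -p.2) ∈ strip D (-d) (-c) := by
      intro p c d
      simp only [mem_strip, hflip]
      refine and_congr_right fun _ => ?_
      omega
    have hdown := hup.downPair val hval hcl hX hmin l hl hann
    refine (hdown.upPair.hasPeriodic_of_strip val hval (hX.reframe rowFlip) (l.map rowFlip.symm) ?_
      (diffs_map_symm_eq_zero rowFlip val l hann) (D := D.map rowFlip.toEquiv.toEmbedding) ?_
      (a := -b) (b := -a) (i := o') (o := o) (k := k) (fun s hs => ?_) (fun s hs => ?_)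
      (by omega) ?_).of_reframe
    · intro u hu
      obtain ⟨v, hv, rfl⟩ := List.mem_map.1 hu
      simpa using hl v hv
    · exact hD.map rowFlip
    · rw [hflip, neg_neg]
      exact (ho' _).2 (by omega)
    · rw [hflip, neg_neg]
      exact (ho _).2 (by omega)
    · refine (complexity_reframe_le rowFlip (T := strip D a b) fun p hp => ?_).trans_lt
        (h1.trans_le (Nat.add_le_add_right
          (le_complexity_reframe rowFlip fun p hp => ?_) k))
      · have := hstrip.1 hp
        rwa [neg_neg, neg_neg] at this
      · rw [hstrip]
        simp only [mem_strip] at hp ⊢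
        change (p.1, - -p.2) ∈ D ∧ _ ≤ - -p.2 ∧ - -p.2 ≤ _
        rw [neg_neg]
        exact ⟨hp.1, by omega, by omega⟩

end

lemma Invariant.closure {A : Type*} [TopologicalSpace A] {S : Set (ℤ × ℤ → A)}
    (hS : Invariant S) : Invariant (closure S) :=
  fun _ hx t => map_mem_closure (continuous_pi fun _ => continuous_apply _) hx fun y hy => hS y hy t

lemma invariant_range_shift {A : Type*} (x : ℤ × ℤ → A) :
    Invariant (Set.range fun t => shift t x) := by
  rintro _ ⟨s, rfl⟩ t
  refine ⟨t + s, ?_⟩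
  funext p
  simp only [shift, add_assoc]

lemma continuous_diffs (l : List (ℤ × ℤ)) : Continuous (diffs l) := by
  induction l with
  | nil => exact continuous_id
  | cons u l ih =>
    exact ih.comp (continuous_pi fun p => (continuous_apply _).sub (continuous_apply _))

section

variable {A : Type*} [TopologicalSpace A] [DiscreteTopology A]

lemma exists_mem_eqOn_of_mem_closure {S : Set (ℤ × ℤ → A)} {x : ℤ × ℤ → A} (hx : x ∈ closure S)
    (E : Finset (ℤ × ℤ)) : ∃ y ∈ S, ∀ p ∈ E, y p = x p := by
  have hopen : IsOpen (⋂ p ∈ E, {y : ℤ × ℤ → A | y p = x p}) :=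
    isOpen_biInter_finset fun p _ =>
      (isOpen_discrete {x p}).preimage (continuous_apply (A := fun _ : ℤ × ℤ => A) p)
  obtain ⟨y, hy, hyS⟩ := mem_closure_iff.1 hx _ hopen (by simp)
  exact ⟨y, hyS, by simpa using hy⟩

lemma diffs_eq_zero_of_mem_closure (val : A → ℤ) (l : List (ℤ × ℤ)) {S : Set (ℤ × ℤ → A)}
    (hS : ∀ x ∈ S, diffs l (val ∘ x) = 0) : ∀ x ∈ closure S, diffs l (val ∘ x) = 0 := by
  have hcont : Continuous fun x : ℤ × ℤ → A => diffs l (val ∘ x) :=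
    (continuous_diffs l).comp
      (continuous_pi fun p => continuous_of_discreteTopology.comp (continuous_apply p))
  exact closure_minimal hS (isClosed_eq hcont continuous_const)

variable [Finite A]

lemma exists_minimal {Y : Set (ℤ × ℤ → A)} (hcl : IsClosed Y) (hY : Invariant Y)
    (hne : Y.Nonempty) :
    ∃ X ⊆ Y, IsClosed X ∧ Invariant X ∧ X.Nonempty ∧ OrbitsDense X := by
  obtain ⟨X, hXY, hmin⟩ := zorn_superset_nonempty
    {X : Set (ℤ × ℤ → A) | IsClosed X ∧ Invariant X ∧ X.Nonempty} (fun C hC hchain hCne => by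
      refine ⟨⋂₀ C, ⟨isClosed_sInter fun s hs => (hC hs).1, fun x hx t s hs =>
        (hC hs).2.1 x (hx s hs) t, ?_⟩, fun s hs => Set.sInter_subset_of_mem hs⟩
      have := hCne.to_subtype
      exact IsCompact.nonempty_sInter_of_directed_nonempty_isCompact_isClosed
        (fun s hs t ht => (hchain.total hs ht).elim (fun h => ⟨s, hs, subset_rfl, h⟩)
          fun h => ⟨t, ht, h, subset_rfl⟩) (fun s hs => (hC hs).2.2)
        (fun s hs => (hC hs).1.isCompact) fun s hs => (hC hs).1) Y ⟨hcl, hY, hne⟩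
  obtain ⟨hXcl, hX, hXne⟩ := hmin.prop
  refine ⟨X, hXY, hXcl, hX, hXne, fun x hx y hy E => ?_⟩
  have hsub : closure (Set.range fun t => shift t x) ⊆ X :=
    closure_minimal (by rintro _ ⟨t, rfl⟩; exact hX x hx t) hXcl
  have hmem : y ∈ closure (Set.range fun t => shift t x) :=
    hmin.le_of_le ⟨isClosed_closure, (invariant_range_shift x).closure,
      (Set.range_nonempty _).closure⟩ hsub hy
  obtain ⟨_, ⟨t, rfl⟩, h⟩ := exists_mem_eqOn_of_mem_closure hmem E
  exact ⟨t, h⟩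

end

section

variable {A : Type*} [Finite A]

/-- A configuration of low complexity is annihilated, up to a constant, by a nontrivial integral
combination of translations. -/
lemma exists_combination_eq_const (val : A → ℤ) (c : ℤ × ℤ → A) (D : Finset (ℤ × ℤ))
    (hlow : complexity (Set.range fun t => shift t c) D ≤ D.card) :
    ∃ (a : ℤ × ℤ → ℤ) (κ : ℤ), (∃ u ∈ D, a u ≠ 0) ∧ ∀ q, ∑ u ∈ D, a u * val (c (u + q)) = κ := by
  classical
  set P : Set (D → A) := (fun (x : ℤ × ℤ → A) (p : D) => x p) '' Set.range fun t => shift t c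
    with hP
  have hmem : ∀ q, (fun p : D => c (p + q)) ∈ P := fun q => ⟨_, ⟨q, rfl⟩, rfl⟩
  have : Fintype P := Fintype.ofFinite P
  let f : (Option D → ℤ) →ₗ[ℤ] (P → ℤ) :=
    { toFun := fun a p => ∑ u : D, a (some u) * val (p.1 u) + a none
      map_add' := fun a b => by
        funext p
        simp only [Pi.add_apply, add_mul, Finset.sum_add_distrib]
        ring
      map_smul' := fun r a => by
        funext p
        simp only [Pi.smul_apply, smul_eq_mul, mul_assoc, RingHom.id_apply, mul_add,
          Finset.mul_sum] }
  have hf : ¬ Function.Injective f := fun hinj => by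
    have h1 := card_le_of_injective ℤ f hinj
    rw [Fintype.card_option, Fintype.card_coe, ← Nat.card_eq_fintype_card] at h1
    have h2 : Nat.card P ≤ D.card := hlow
    omega
  rw [injective_iff_map_eq_zero] at hf
  push Not at hf
  obtain ⟨a, ha, hne⟩ := hf
  have key : ∀ q, ∑ u : D, a (some u) * val (c (u + q)) = -a none := fun q =>
    eq_neg_of_add_eq_zero_left (congrFun ha ⟨_, hmem q⟩)
  refine ⟨fun u => if h : u ∈ D then a (some ⟨u, h⟩) else 0, -a none, ?_, fun q => ?_⟩
  · by_contra! hall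
    have h0 : ∀ u : D, a (some u) = 0 := fun u => by simpa using hall u u.2
    refine hne (funext fun u => ?_)
    cases u with
    | none => simpa [h0] using (key 0).symm
    | some u => exact h0 u
  · rw [← key q, ← Finset.sum_coe_sort D]
    exact Finset.sum_congr rfl fun u _ => by simp

lemma exists_diffs_eq_zero_of_low_complexity (val : A → ℤ) (c : ℤ × ℤ → A) (D : Finset (ℤ × ℤ))
    (hlow : complexity (Set.range fun t => shift t c) D ≤ D.card) :
    ∃ l : List (ℤ × ℤ), (∀ u ∈ l, u ≠ 0) ∧ diffs l (val ∘ c) = 0 := by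
  obtain ⟨a, κ, ⟨u₀, hu₀, ha⟩, h⟩ := exists_combination_eq_const val c D hlow
  obtain ⟨l, hl, hl'⟩ := exists_diffs_of_annihilator (D.map (Equiv.neg (ℤ × ℤ)).toEmbedding)
    (fun u => a (-u)) (-u₀) (by simpa using hu₀) (by simpa using ha) (diff (1, 0) (val ∘ c))
    ((bdd_comp val c).diff _) (fun q => by
      have h1 := h q
      have h2 := h (q - (1, 0))
      simp only [Finset.sum_map, Equiv.coe_toEmbedding, Equiv.neg_apply, neg_neg, sub_neg_eq_add,
        diff, Function.comp_apply, mul_sub, Finset.sum_sub_distrib]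
      rw [sub_eq_zero]
      simp only [← add_sub_assoc, add_comm _ q] at h1 h2
      rw [h1, h2])
  refine ⟨(1, 0) :: l, ?_, hl'⟩
  simpa using hl

end

section

variable {A : Type*} [Finite A] [TopologicalSpace A] [DiscreteTopology A]

theorem hasPeriodic_closure_of_low_complexity (c : ℤ × ℤ → A) (a b a' b' : ℤ)
    (hlow : complexity (Set.range fun t => shift t c) (Finset.Icc a b ×ˢ Finset.Icc a' b') ≤
      (Finset.Icc a b ×ˢ Finset.Icc a' b').card) :
    HasPeriodic (closure (Set.range fun t => shift t c)) := by
  obtain ⟨val, hval⟩ : ∃ val : A → ℤ, Function.Injective val := by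
    obtain ⟨n, ⟨e⟩⟩ := Finite.exists_equiv_fin A
    exact ⟨fun a => (e a : ℕ), fun x y h => e.injective (Fin.ext (Int.ofNat.inj h))⟩
  obtain ⟨l, hl, hlc⟩ := exists_diffs_eq_zero_of_low_complexity val c _ hlow
  obtain ⟨X, hXY, hcl, hX, hne, hmin⟩ := exists_minimal isClosed_closure
    (invariant_range_shift c).closure (Set.range_nonempty _).closure
  suffices HasPeriodic X by
    obtain ⟨x, hx, h⟩ := this
    exact ⟨x, hXY hx, h⟩
  by_contra hper
  have hann : ∀ x ∈ X, diffs l (val ∘ x) = 0 := by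
    refine fun x hx => diffs_eq_zero_of_mem_closure val l ?_ x (hXY hx)
    rintro _ ⟨t, rfl⟩
    refine (diffs_translate l (val ∘ c) t).trans ?_
    rw [hlc]
    rfl
  obtain ⟨u, hu, x, hx, y, hy, hxy, hne'⟩ := exists_halfspace_pair hcl hX hne hper
  obtain ⟨M, hM⟩ := exists_reframe_upPair val hval l hl hann hu hx hy hxy hne'
  set D := Finset.Icc a b ×ˢ Finset.Icc a' b' with hD
  refine hper (hM.hasPeriodic val hval (hcl.reframe M) (hX.reframe M) (hmin.reframe M)
    (l.map M.symm) (fun v hv => ?_) (diffs_map_symm_eq_zero M val l hann)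
    ((latticeConvex_Icc_product a b a' b').map M.symm) ?_).of_reframe
  · obtain ⟨w, hw, rfl⟩ := List.mem_map.1 hv
    simpa using hl w hw
  · rw [Finset.card_map]
    refine (complexity_reframe_le M (T := D) fun p hp => Finset.mem_map_equiv.1 hp).trans
      (le_trans (complexity_le_of_forall_exists id fun x hx => ?_) hlow)
    obtain ⟨y, hy, h⟩ := exists_mem_eqOn_of_mem_closure (hXY hx) D
    exact ⟨y, hy, funext fun p => h p p.2⟩

end

end LowComplexity

/-- If a configuration over a finite alphabet has low complexity
with respect to a rectangle `{1,…,n} × {1,…,m}` (at most `n·m` distinct rectangular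
patterns), then its orbit closure contains a periodic configuration. -/
theorem orbitClosure_contains_periodic_of_low_complexity_rect
    {A : Type*} [Fintype A] [TopologicalSpace A] [DiscreteTopology A]
    (c : ℤ × ℤ → A) (n m : ℕ) (hn : 1 ≤ n) (hm : 1 ≤ m)
    (hlc : (patterns c (rect n m)).ncard ≤ n * m) :
    ∃ c' ∈ orbitClosure c, Periodic c' := by
  have horbit : orbit c = Set.range fun t => LowComplexity.shift t c := by
    ext d
    constructor
    · rintro ⟨t, rfl⟩
      exact ⟨-t, by funext p; simp [LowComplexity.shift, Translate, sub_eq_add_neg]⟩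
    · rintro ⟨t, rfl⟩
      exact ⟨-t, by funext p; simp [LowComplexity.shift, Translate]⟩
  have hfin : Finite (rect n m) :=
    Set.Finite.subset (Finset.Icc (1 : ℤ) n ×ˢ Finset.Icc (1 : ℤ) m).finite_toSet fun p hp => by
      simp only [Finset.coe_product, Finset.coe_Icc, Set.mem_prod, Set.mem_Icc]
      exact ⟨⟨hp.1, hp.2.1⟩, hp.2.2.1, hp.2.2.2⟩
  obtain ⟨x, hx, t, ht, h⟩ :=
      LowComplexity.hasPeriodic_closure_of_low_complexity c 1 n 1 m (by
    rw [Finset.card_product, Int.card_Icc, Int.card_Icc, add_sub_cancel_right,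
      add_sub_cancel_right, Int.toNat_natCast, Int.toNat_natCast]
    refine le_trans ?_ hlc
    refine (Set.ncard_le_ncard ?_ (Set.toFinite _)).trans (Set.ncard_image_le
      (f := fun (g : rect n m → A) (p : (Finset.Icc (1 : ℤ) n ×ˢ Finset.Icc (1 : ℤ) m :)) =>
        g ⟨p.1, by
          have := p.2
          simp only [Finset.mem_product, Finset.mem_Icc] at this
          exact ⟨this.1.1, this.1.2, this.2.1, this.2.2⟩⟩) ?_)
    · rintro _ ⟨_, ⟨t, rfl⟩, rfl⟩
      exact ⟨fun p => Translate (-t) c p, ⟨-t, fun p => rfl⟩, by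
        funext p
        simp [LowComplexity.shift, Translate]⟩
    · exact Set.toFinite _)
  refine ⟨x, ?_, -t, neg_ne_zero.2 ht, ?_⟩
  · rwa [orbitClosure, horbit]
  · funext p
    simpa [Translate] using h p
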